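/- Let $n>4$ with $\frac{n}{n-2}>2\alpha^{\sharp}$, where $\alpha^{\sharp}$ is the second largest real root of $X^3-8X+4$, and let $\alpha^*$ be the largest real root of $X^3-8X+4$. Let $u\in C^4(\mathbb{R}^n)$ satisfy $\Delta^2 u=e^u$ on $\mathbb{R}^n$, be stable outside the ball $B_R$ (in the fourth-order sense), and have $\Delta u(x)\to0$ as $|x|\to\infty$. Set $\bar\alpha:=\max\{\frac{n}{n-2}\min\{\frac n4,\alpha^*\},\ \min\{\frac n4,\alpha^*\}+\frac12\}$. Then for every $p\in[1,\bar\alpha)$ there exists $C=C(p)>0$ such that $\int_{B_{2r}\setminus B_r}e^{p\,u}\,dx \le C r^{n-4p}$ for all sufficiently large $r$; and for every $p\in[1,\min\{\frac n4,\alpha^*\})$ there is $C=C(p)$ with $\int_{B_r\setminus B_{2R}}e^{p\,u}\,dx \le C r^{n-4p}$ for all sufficiently large $r$. -/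

import Mathlib

open MeasureTheory Metric Filter Set

noncomputable section

/-- Euclidean space `ℝ^n`. -/
abbrev En (n : ℕ) : Type := EuclideanSpace ℝ (Fin n)

/-- The Laplacian of `f` at `x`: the trace of the Hessian,
`Δ f (x) = ∑ i ∂²f/∂xᵢ² (x)`. -/
def lap {m : ℕ} (f : EuclideanSpace ℝ (Fin m) → ℝ) (x : EuclideanSpace ℝ (Fin m)) : ℝ :=
  ∑ i, fderiv ℝ (fun y => fderiv ℝ f y (EuclideanSpace.single i (1:ℝ))) x
      (EuclideanSpace.single i (1:ℝ))

/-- `φ ∈ C_c^∞(S)`: smooth, compactly supported, with (closed) support contained in `S`. -/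
def TestOn (n : ℕ) (S : Set (En n)) (φ : En n → ℝ) : Prop :=
  ContDiff ℝ (⊤ : ℕ∞) φ ∧ HasCompactSupport φ ∧ tsupport φ ⊆ S

/-- `u` is stable outside the ball `B_R` in the fourth-order sense:
`∫ e^u φ² ≤ ∫ (Δφ)²` for all `φ ∈ C_c^∞(ℝ^n \ closure B_R)`. -/
def Stable4OutsideBall (n : ℕ) (u : En n → ℝ) (R : ℝ) : Prop :=
  ∀ φ : En n → ℝ, TestOn n (Metric.closedBall (0 : En n) R)ᶜ φ →
    ∫ x, Real.exp (u x) * φ x ^ 2 ≤ ∫ x, (lap φ x) ^ 2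

/-- The `i`-th partial derivative. -/
def pd {n : ℕ} (i : Fin n) (f : En n → ℝ) (x : En n) : ℝ :=
  fderiv ℝ f x (EuclideanSpace.single i (1 : ℝ))

/-- The squared norm of the gradient. -/
def gradSq {n : ℕ} (f : En n → ℝ) (x : En n) : ℝ := ∑ i, pd i f x ^ 2

section Calculus

variable {n : ℕ} {f g : En n → ℝ}

lemma lap_eq_sum (f : En n → ℝ) (x : En n) : lap f x = ∑ i, pd i (pd i f) x := rfl

lemma ContDiff.pd {k m : WithTop ℕ∞} (hf : ContDiff ℝ m f) (hk : k + 1 ≤ m) (i : Fin n) :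
    ContDiff ℝ k (_root_.pd i f) :=
  (hf.fderiv_right hk).clm_apply contDiff_const

lemma ContDiff.continuous_pd (hf : ContDiff ℝ 1 f) (i : Fin n) : Continuous (_root_.pd i f) :=
  (ContDiff.pd (k := 0) hf (by norm_num) i).continuous

lemma ContDiff.lap {k m : WithTop ℕ∞} (hf : ContDiff ℝ m f) (hk : k + 2 ≤ m) :
    ContDiff ℝ k (_root_.lap f) := by
  have : _root_.lap f = fun x => ∑ i, _root_.pd i (_root_.pd i f) x := rfl
  rw [this]
  refine ContDiff.sum fun i _ => ?_
  refine ContDiff.pd (m := k + 1) (ContDiff.pd hf ?_ i) le_rfl i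
  rw [add_assoc]
  exact (by norm_num : (1 : WithTop ℕ∞) + 1 = 2) ▸ hk

lemma ContDiff.continuous_lap (hf : ContDiff ℝ 2 f) : Continuous (_root_.lap f) :=
  (ContDiff.lap (k := 0) hf (by norm_num)).continuous

lemma ContDiff.continuous_gradSq (hf : ContDiff ℝ 1 f) : Continuous (gradSq f) :=
  continuous_finsetSum _ fun i _ => (hf.continuous_pd i).pow 2

lemma gradSq_nonneg (f : En n → ℝ) (x : En n) : 0 ≤ gradSq f x :=
  Finset.sum_nonneg fun _ _ => sq_nonneg _

lemma pd_add (hf : Differentiable ℝ f) (hg : Differentiable ℝ g) (i : Fin n) (x : En n) :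
    pd i (fun y => f y + g y) x = pd i f x + pd i g x := by
  simp only [pd]; rw [fderiv_fun_add (hf x) (hg x)]; rfl

lemma pd_neg (i : Fin n) (x : En n) : pd i (fun y => -f y) x = -pd i f x := by
  simp only [pd]; rw [fderiv_fun_neg]; rfl

lemma pd_sub (hf : Differentiable ℝ f) (hg : Differentiable ℝ g) (i : Fin n) (x : En n) :
    pd i (fun y => f y - g y) x = pd i f x - pd i g x := by
  simp only [pd]; rw [fderiv_fun_sub (hf x) (hg x)]; rfl

lemma pd_mul (hf : Differentiable ℝ f) (hg : Differentiable ℝ g) (i : Fin n) (x : En n) :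
    pd i (fun y => f y * g y) x = f x * pd i g x + pd i f x * g x := by
  simp only [pd]; rw [fderiv_fun_mul (hf x) (hg x)]
  simp [mul_comm]

lemma pd_const_mul (c : ℝ) (hf : Differentiable ℝ f) (i : Fin n) (x : En n) :
    pd i (fun y => c * f y) x = c * pd i f x := by
  simp only [pd]; rw [fderiv_const_mul (hf x)]; rfl

lemma pd_comp {F F' : ℝ → ℝ} (hf : Differentiable ℝ f) {x : En n}
    (hF : HasDerivAt F (F' (f x)) (f x)) (i : Fin n) :
    pd i (fun y => F (f y)) x = F' (f x) * pd i f x := by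
  have h := hF.hasFDerivAt.comp x (hf x).hasFDerivAt
  have h2 : fderiv ℝ (fun y => F (f y)) x = _ := h.fderiv
  simp only [pd]; rw [h2]; simp [mul_comm]

lemma lap_add (hf : ContDiff ℝ 2 f) (hg : ContDiff ℝ 2 g) (x : En n) :
    lap (fun y => f y + g y) x = lap f x + lap g x := by
  have hf1 := hf.differentiable (by norm_num)
  have hg1 := hg.differentiable (by norm_num)
  simp only [lap_eq_sum, ← Finset.sum_add_distrib]
  refine Finset.sum_congr rfl fun i _ => ?_
  rw [funext (pd_add hf1 hg1 i), pd_add]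
  · exact (ContDiff.pd (k := 1) hf (by norm_num) i).differentiable (by norm_num)
  · exact (ContDiff.pd (k := 1) hg (by norm_num) i).differentiable (by norm_num)

lemma lap_neg (x : En n) : lap (fun y => -f y) x = -lap f x := by
  simp only [lap_eq_sum, ← Finset.sum_neg_distrib]
  refine Finset.sum_congr rfl fun i _ => ?_
  rw [funext (pd_neg (f := f) i), pd_neg]

lemma lap_sub (hf : ContDiff ℝ 2 f) (hg : ContDiff ℝ 2 g) (x : En n) :
    lap (fun y => f y - g y) x = lap f x - lap g x := by
  simp only [sub_eq_add_neg]
  rw [lap_add hf hg.neg, lap_neg]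

lemma lap_const_mul (c : ℝ) (hf : ContDiff ℝ 2 f) (x : En n) :
    lap (fun y => c * f y) x = c * lap f x := by
  simp only [lap_eq_sum, Finset.mul_sum]
  refine Finset.sum_congr rfl fun i _ => ?_
  rw [funext (pd_const_mul c (hf.differentiable (by norm_num)) i), pd_const_mul]
  exact (ContDiff.pd (k := 1) hf (by norm_num) i).differentiable (by norm_num)

lemma lap_mul (hf : ContDiff ℝ 2 f) (hg : ContDiff ℝ 2 g) (x : En n) :
    lap (fun y => f y * g y) x =
      f x * lap g x + lap f x * g x + 2 * ∑ i, pd i f x * pd i g x := by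
  have hf1 := hf.differentiable (by norm_num)
  have hg1 := hg.differentiable (by norm_num)
  simp only [lap_eq_sum, Finset.mul_sum, Finset.sum_mul, ← Finset.sum_add_distrib]
  refine Finset.sum_congr rfl fun i _ => ?_
  have hf2 := (ContDiff.pd (k := 1) hf (by norm_num) i).differentiable (by norm_num)
  have hg2 := (ContDiff.pd (k := 1) hg (by norm_num) i).differentiable (by norm_num)
  rw [funext (pd_mul hf1 hg1 i),
    pd_add (f := fun y => f y * pd i g y) (g := fun y => pd i f y * g y)
      (hf1.mul hg2) (hf2.mul hg1), pd_mul hf1 hg2,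
    pd_mul hf2 hg1]
  ring

lemma lap_comp {F F' F'' : ℝ → ℝ} {s : Set ℝ} (hf : ContDiff ℝ 2 f) (hs : ∀ y, f y ∈ s)
    (hF : ∀ t ∈ s, HasDerivAt F (F' t) t) (hF' : ∀ t ∈ s, HasDerivAt F' (F'' t) t) (x : En n) :
    lap (fun y => F (f y)) x = F' (f x) * lap f x + F'' (f x) * gradSq f x := by
  have hf1 := hf.differentiable (by norm_num)
  simp only [lap_eq_sum, gradSq, Finset.mul_sum, ← Finset.sum_add_distrib]
  refine Finset.sum_congr rfl fun i _ => ?_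
  have hf2 := (ContDiff.pd (k := 1) hf (by norm_num) i).differentiable (by norm_num)
  have hd : Differentiable ℝ (fun y => F' (f y)) := fun y =>
    ((hF' _ (hs y)).differentiableAt).comp y (hf1 y)
  rw [funext fun y => pd_comp (F := F) (F' := F') hf1 (hF _ (hs y)) i, pd_mul hd hf2,
    pd_comp (F := F') (F' := F'') hf1 (hF' _ (hs x)) i]
  ring

lemma gradSq_comp {F F' : ℝ → ℝ} (hf : Differentiable ℝ f) {x : En n}
    (hF : HasDerivAt F (F' (f x)) (f x)) :
    gradSq (fun y => F (f y)) x = F' (f x) ^ 2 * gradSq f x := by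
  simp only [gradSq, Finset.mul_sum]
  refine Finset.sum_congr rfl fun i _ => ?_
  rw [pd_comp (F' := F') hf hF]; ring

lemma gradSq_mul (hf : Differentiable ℝ f) (hg : Differentiable ℝ g) (x : En n) :
    gradSq (fun y => f y * g y) x = gradSq f x * g x ^ 2 + f x ^ 2 * gradSq g x +
      2 * ∑ i, (f x * pd i f x) * (g x * pd i g x) := by
  simp only [gradSq, Finset.mul_sum, Finset.sum_mul, ← Finset.sum_add_distrib]
  refine Finset.sum_congr rfl fun i _ => ?_
  rw [pd_mul hf hg]; ring

lemma tsupport_pd_subset (i : Fin n) : tsupport (pd i f) ⊆ tsupport f :=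
  (tsupport_comp_subset (g := fun L : En n →L[ℝ] ℝ => L (EuclideanSpace.single i 1)) rfl _).trans
    (tsupport_fderiv_subset ℝ)

lemma HasCompactSupport.pd (hf : HasCompactSupport f) (i : Fin n) :
    HasCompactSupport (_root_.pd i f) :=
  hf.mono' (subset_tsupport _ |>.trans (tsupport_pd_subset i))

lemma tsupport_lap_subset : tsupport (lap f) ⊆ tsupport f := by
  refine closure_minimal (fun x hx => ?_) (isClosed_tsupport f)
  obtain ⟨i, -, hi⟩ := Finset.exists_ne_zero_of_sum_ne_zero (show ∑ i, pd i (pd i f) x ≠ 0 from hx)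
  exact tsupport_pd_subset i (tsupport_pd_subset i (subset_tsupport _ hi))

lemma HasCompactSupport.lap (hf : HasCompactSupport f) : HasCompactSupport (_root_.lap f) :=
  hf.mono' (subset_tsupport _ |>.trans tsupport_lap_subset)

lemma integral_mul_pd (hf : ContDiff ℝ 1 f) (hg : ContDiff ℝ 1 g) (hc : HasCompactSupport g)
    (i : Fin n) : ∫ x, f x * pd i g x = -∫ x, pd i f x * g x := by
  refine integral_mul_fderiv_eq_neg_fderiv_mul_of_integrable ?_ ?_ ?_ ?_ ?_
  · exact ((hf.continuous_pd i).mul hg.continuous).integrable_of_hasCompactSupport hc.mul_left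
  · exact (hf.continuous.mul (hg.continuous_pd i)).integrable_of_hasCompactSupport
      (HasCompactSupport.pd hc i).mul_left
  · exact (hf.continuous.mul hg.continuous).integrable_of_hasCompactSupport hc.mul_left
  · exact fun x _ => hf.differentiable (by norm_num) x
  · exact fun x _ => hg.differentiable (by norm_num) x

/-- Green's formula. -/
lemma integral_mul_lap (hf : ContDiff ℝ 1 f) (hg : ContDiff ℝ 2 g) (hc : HasCompactSupport g) :
    ∫ x, f x * lap g x = -∫ x, ∑ i, pd i f x * pd i g x := by
  have hg' (i : Fin n) : ContDiff ℝ 1 (pd i g) := ContDiff.pd hg (by norm_num) i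
  simp only [lap_eq_sum, Finset.mul_sum]
  rw [integral_finsetSum, integral_finsetSum, ← Finset.sum_neg_distrib]
  · exact Finset.sum_congr rfl fun i _ => integral_mul_pd hf (hg' i) (HasCompactSupport.pd hc i) i
  · exact fun i _ => ((hf.continuous_pd i).mul (hg' i).continuous).integrable_of_hasCompactSupport
      (HasCompactSupport.pd hc i).mul_left
  · exact fun i _ => (hf.continuous.mul ((hg' i).continuous_pd i)).integrable_of_hasCompactSupport
      (HasCompactSupport.pd (HasCompactSupport.pd hc i) i).mul_left

/-- Green's second identity. -/
lemma integral_lap_mul (hf : ContDiff ℝ 2 f) (hg : ContDiff ℝ 2 g) (hc : HasCompactSupport g) :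
    ∫ x, lap f x * g x = ∫ x, f x * lap g x := by
  rw [integral_mul_lap (hf.of_le (by norm_num)) hg hc]
  have hf' (i : Fin n) : ContDiff ℝ 1 (pd i f) := ContDiff.pd hf (by norm_num) i
  have hg1 : ContDiff ℝ 1 g := hg.of_le (by norm_num)
  have key (i : Fin n) : ∫ x, pd i (pd i f) x * g x = -∫ x, pd i f x * pd i g x := by
    rw [integral_mul_pd (hf' i) hg1 hc, neg_neg]
  simp only [lap_eq_sum, Finset.sum_mul]
  rw [integral_finsetSum, integral_finsetSum, ← Finset.sum_neg_distrib]
  · exact Finset.sum_congr rfl fun i _ => key i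
  · exact fun i _ => ((hf' i).continuous.mul (hg1.continuous_pd i)).integrable_of_hasCompactSupport
      (HasCompactSupport.pd hc i).mul_left
  · exact fun i _ => (((hf' i).continuous_pd i).mul hg1.continuous).integrable_of_hasCompactSupport
      hc.mul_left

lemma norm_fderiv_sq_le_gradSq (x : En n) : ‖fderiv ℝ f x‖ ^ 2 ≤ gradSq f x := by
  have h : ‖fderiv ℝ f x‖ ≤ Real.sqrt (gradSq f x) := by
    refine ContinuousLinearMap.opNorm_le_bound _ (Real.sqrt_nonneg _) fun y => ?_
    have hy : fderiv ℝ f x y = ∑ i, pd i f x * y i := by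
      conv_lhs => rw [← (EuclideanSpace.basisFun (Fin n) ℝ).sum_repr y]
      simp [pd, mul_comm]
    rw [hy, EuclideanSpace.norm_eq, ← Real.sqrt_mul (gradSq_nonneg f x)]
    refine Real.abs_le_sqrt ?_
    simpa [gradSq] using Finset.sum_mul_sq_le_sq_mul_sq Finset.univ (fun i => pd i f x) (fun i => y i)
  calc ‖fderiv ℝ f x‖ ^ 2 ≤ Real.sqrt (gradSq f x) ^ 2 := by gcongr
    _ = gradSq f x := Real.sq_sqrt (gradSq_nonneg f x)

/-- At a local maximum the Laplacian is nonpositive. -/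
lemma lap_nonpos_of_isLocalMax (hf : ContDiff ℝ 2 f) {x : En n} (hx : IsLocalMax f x) :
    lap f x ≤ 0 := by
  rw [lap_eq_sum]
  refine Finset.sum_nonpos fun i _ => ?_
  set e : En n := EuclideanSpace.single i (1 : ℝ)
  have hl (t : ℝ) : HasDerivAt (fun s : ℝ => x + s • e) e t := by
    simpa using ((hasDerivAt_id t).smul_const e).const_add x
  have h1 : deriv (fun s : ℝ => f (x + s • e)) = fun t => pd i f (x + t • e) := by
    ext t
    exact (((hf.differentiable (by norm_num) _).hasFDerivAt).comp_hasDerivAt t (hl t)).deriv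
  have h2 : deriv (deriv (fun s : ℝ => f (x + s • e))) 0 = pd i (pd i f) x := by
    rw [h1]
    have hd := (ContDiff.pd (k := 1) hf (by norm_num) i).differentiable (by norm_num)
    have := ((hd (x + (0 : ℝ) • e)).hasFDerivAt.comp_hasDerivAt 0 (hl 0)).deriv
    simpa [Function.comp_def, pd] using this
  have hcont : Continuous (fun s : ℝ => x + s • e) := by fun_prop
  have hmax : IsLocalMax (fun s : ℝ => f (x + s • e)) 0 := by
    have ht : Tendsto (fun s : ℝ => x + s • e) (nhds 0) (nhds x) := by
      simpa using hcont.tendsto 0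
    have := ht.eventually hx
    simpa [IsLocalMax, IsMaxFilter] using this
  by_contra! hpos
  rw [← h2] at hpos
  have hmin := isLocalMin_of_deriv_deriv_pos hpos hmax.deriv_eq_zero
    (hf.continuous.comp hcont).continuousAt
  have hconst : (fun s : ℝ => f (x + s • e)) =ᶠ[nhds 0] fun _ => f x := by
    filter_upwards [hmax, hmin] with s hs hs'
    simp only [zero_smul, add_zero] at hs hs'
    exact le_antisymm hs hs'
  have h3 : deriv (deriv (fun s : ℝ => f (x + s • e))) 0 = 0 := by
    have : deriv (fun s : ℝ => f (x + s • e)) =ᶠ[nhds 0] deriv (fun _ : ℝ => f x) := hconst.deriv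
    rw [this.deriv_eq]; simp
  linarith

end Calculus

section Comparison

variable {n : ℕ}

lemma hasFDerivAt_norm_sub_sq (x₀ x : En n) :
    HasFDerivAt (fun y : En n => ‖y - x₀‖ ^ 2) (2 • (innerSL ℝ (x - x₀))) x := by
  exact (hasStrictFDerivAt_norm_sq (x - x₀)).hasFDerivAt.comp x ((hasFDerivAt_id x).sub_const x₀)

lemma pd_norm_sub_sq (x₀ x : En n) (i : Fin n) :
    pd i (fun y : En n => ‖y - x₀‖ ^ 2) x = 2 * (x i - x₀ i) := by
  rw [pd, (hasFDerivAt_norm_sub_sq x₀ x).fderiv]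
  simp [EuclideanSpace.inner_single_right]

lemma contDiff_norm_sub_sq (x₀ : En n) {k : WithTop ℕ∞} :
    ContDiff ℝ k (fun y : En n => ‖y - x₀‖ ^ 2) :=
  (contDiff_id.sub contDiff_const).norm_sq ℝ

lemma gradSq_norm_sub_sq (x₀ x : En n) :
    gradSq (fun y : En n => ‖y - x₀‖ ^ 2) x = 4 * ‖x - x₀‖ ^ 2 := by
  simp only [gradSq, pd_norm_sub_sq]
  rw [EuclideanSpace.norm_sq_eq, Finset.mul_sum]
  refine Finset.sum_congr rfl fun i _ => ?_
  simp; ring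

lemma pd_coord (x : En n) (i : Fin n) (c : ℝ) : pd i (fun y : En n => 2 * (y i - c)) x = 2 := by
  have h : HasFDerivAt (fun y : En n => y i)
      (EuclideanSpace.proj i : En n →L[ℝ] ℝ) x :=
    (EuclideanSpace.proj i : En n →L[ℝ] ℝ).hasFDerivAt
  have h2 : HasFDerivAt (fun y : En n => 2 * (y i - c)) _ x := (h.sub_const c).const_mul 2
  rw [pd, h2.fderiv]
  simp

lemma lap_norm_sub_sq (x₀ x : En n) :
    lap (fun y : En n => ‖y - x₀‖ ^ 2) x = 2 * n := by
  rw [lap_eq_sum, Finset.sum_congr rfl fun i _ => by rw [funext fun y => pd_norm_sub_sq x₀ y i, pd_coord]]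
  simp [mul_comm]

/-- Interior Keller-Osserman bound. -/
lemma keller_osserman_bound {w : En n → ℝ} (hw : ContDiff ℝ 2 w)
    (h : ∀ x, 0 < w x → w x ^ 2 / 2 ≤ lap w x) (x₀ : En n) {ρ : ℝ} (hρ : 0 < ρ) :
    w x₀ * ρ ^ 2 ≤ 2 * (4 * n + 24) := by
  rcases le_or_gt (w x₀) 0 with h0 | h0
  · have : w x₀ * ρ ^ 2 ≤ 0 := mul_nonpos_of_nonpos_of_nonneg h0 (sq_nonneg _)
    have : (0 : ℝ) ≤ n := Nat.cast_nonneg n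
    linarith
  set q : En n → ℝ := fun y => ρ ^ 2 - ‖y - x₀‖ ^ 2
  have hq : ContDiff ℝ 2 q := contDiff_const.sub (contDiff_norm_sub_sq x₀)
  have hq1 := hq.differentiable (by norm_num)
  have hs : ContDiff ℝ 2 (fun y : En n => ‖y - x₀‖ ^ 2) := contDiff_norm_sub_sq x₀
  have hpq (i : Fin n) (x : En n) : pd i q x = -(2 * (x i - x₀ i)) := by
    rw [pd_sub (differentiable_const _) (hs.differentiable (by norm_num)), pd_norm_sub_sq]
    simp [pd]
  have hgq (x : En n) : gradSq q x = 4 * ‖x - x₀‖ ^ 2 := by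
    rw [← gradSq_norm_sub_sq x₀ x]
    simp only [gradSq, hpq, pd_norm_sub_sq, neg_sq]
  have hlq (x : En n) : lap q x = -(2 * n) := by
    rw [lap_sub contDiff_const hs, lap_norm_sub_sq]
    simp [lap]
  have hq2 : ContDiff ℝ 2 (fun y => q y * q y) := hq.mul hq
  set z : En n → ℝ := fun y => w y * (q y * q y)
  have hz : ContDiff ℝ 2 z := hw.mul hq2
  obtain ⟨x, hxB, hmax⟩ := (isCompact_closedBall x₀ ρ).exists_isMaxOn
    ⟨x₀, mem_closedBall_self hρ.le⟩ hz.continuous.continuousOn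
  have hz0 : z x₀ = w x₀ * ρ ^ 4 := by simp [z, q]; left; ring
  have hzx : z x₀ ≤ z x := hmax (mem_closedBall_self hρ.le)
  have hzpos : 0 < z x := lt_of_lt_of_le (by rw [hz0]; positivity) hzx
  have hqne : q x ≠ 0 := by
    intro hc; simp [z, hc] at hzpos
  have hd : ‖x - x₀‖ ≤ ρ := by simpa [dist_eq_norm] using hxB
  have hqn : 0 ≤ q x := by
    have := pow_le_pow_left₀ (norm_nonneg _) hd 2
    simp only [q]; linarith
  have hqpos : 0 < q x := lt_of_le_of_ne hqn (Ne.symm hqne)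
  have hwpos : 0 < w x := by
    by_contra! hc
    have : z x ≤ 0 := mul_nonpos_of_nonpos_of_nonneg hc (mul_self_nonneg _)
    linarith
  have hlt : ‖x - x₀‖ < ρ := by
    refine lt_of_le_of_ne hd fun hc => hqne ?_
    simp [q, hc]
  have hloc : IsLocalMax z x :=
    hmax.isLocalMax (closedBall_mem_nhds_of_mem (by simpa [dist_eq_norm] using hlt))
  have hlap := lap_nonpos_of_isLocalMax hz hloc
  have hgrad (i : Fin n) : q x * pd i w x = -(2 * (w x * pd i q x)) := by
    have h0 : pd i z x = 0 := by simp [pd, hloc.fderiv_eq_zero]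
    rw [pd_mul (hw.differentiable (by norm_num)) (hq2.differentiable (by norm_num)),
      pd_mul hq1 hq1] at h0
    have : q x * (q x * pd i w x + 2 * (w x * pd i q x)) = 0 := by linear_combination h0
    rcases mul_eq_zero.1 this with h1 | h1
    · exact absurd h1 hqne
    · linarith
  have hcross : ∑ i, pd i w x * pd i (fun y => q y * q y) x = -(4 * (w x * gradSq q x)) := by
    simp only [gradSq, Finset.mul_sum, ← Finset.sum_neg_distrib]
    refine Finset.sum_congr rfl fun i _ => ?_
    rw [pd_mul hq1 hq1]
    linear_combination 2 * pd i q x * hgrad i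
  rw [lap_mul hw hq2, lap_mul hq hq, hcross] at hlap
  have hsum : ∑ i, pd i q x * pd i q x = gradSq q x := by simp [gradSq, sq]
  rw [hsum, hgq, hlq] at hlap
  have hmain := h x hwpos
  have hn : (0 : ℝ) ≤ n := Nat.cast_nonneg n
  have hq_le : q x ≤ ρ ^ 2 := by simp [q]
  have hd2 : ‖x - x₀‖ ^ 2 ≤ ρ ^ 2 := pow_le_pow_left₀ (norm_nonneg _) hd 2
  have h1 : w x * (w x * q x ^ 2 / 2) ≤ w x * ((4 * n + 24) * ρ ^ 2) := by
    have e1 : w x ^ 2 / 2 * q x ^ 2 ≤ lap w x * q x ^ 2 := by gcongr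
    have e2 : 4 * n * (w x * q x) ≤ 4 * n * (w x * ρ ^ 2) := by gcongr
    have e3 : w x * ‖x - x₀‖ ^ 2 ≤ w x * ρ ^ 2 := by gcongr
    nlinarith
  have h2 := le_of_mul_le_mul_left h1 hwpos
  have h3 : w x₀ * ρ ^ 4 ≤ 2 * (4 * n + 24) * ρ ^ 2 := by
    rw [← hz0]
    have : z x = w x * q x ^ 2 := by simp [z, sq]
    linarith
  have : ρ ^ 2 * (w x₀ * ρ ^ 2) ≤ ρ ^ 2 * (2 * (4 * n + 24)) := by linarith
  exact le_of_mul_le_mul_left this (by positivity)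

/-- An entire solution of `Δ w ≥ w² / 2` on `{w > 0}` is nonpositive. -/
lemma keller_osserman {w : En n → ℝ} (hw : ContDiff ℝ 2 w)
    (h : ∀ x, 0 < w x → w x ^ 2 / 2 ≤ lap w x) (x : En n) : w x ≤ 0 := by
  by_contra! hpos
  set K : ℝ := 2 * (4 * n + 24)
  have hK : 0 < K := by positivity
  have hb := keller_osserman_bound hw h x (ρ := Real.sqrt (2 * K / w x)) (by positivity)
  rw [Real.sq_sqrt (by positivity), mul_div_cancel₀ _ hpos.ne'] at hb
  linarith

variable {u : En n → ℝ}

lemma lap_nonpos_of_tendsto (hu : ContDiff ℝ (4 : ℕ) u)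
    (heq : ∀ x, lap (fun y => lap u y) x = Real.exp (u x))
    (hvanish : Tendsto (fun x => lap u x) (cocompact (En n)) (nhds 0)) (x : En n) :
    lap u x ≤ 0 := by
  by_contra! hpos
  have hl : ContDiff ℝ 2 (lap u) := ContDiff.lap hu (by norm_num)
  obtain ⟨y, hy⟩ := hl.continuous.exists_forall_ge' x
    (hvanish.eventually (eventually_le_nhds hpos))
  have h1 := lap_nonpos_of_isLocalMax hl (Eventually.of_forall hy : IsLocalMax (lap u) y)
  have h2 := heq y
  have := Real.exp_pos (u y)
  change lap (lap u) y = _ at h2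
  linarith

lemma lap_exp_mul (hu : ContDiff ℝ 2 u) (c : ℝ) (x : En n) :
    lap (fun y => Real.exp (c * u y)) x =
      c * Real.exp (c * u x) * lap u x + c ^ 2 * Real.exp (c * u x) * gradSq u x := by
  have hd (t : ℝ) : HasDerivAt (fun t => Real.exp (c * t)) (c * Real.exp (c * t)) t := by
    simpa [mul_comm] using ((hasDerivAt_id t).const_mul c).exp
  have hd2 (t : ℝ) : HasDerivAt (fun t => c * Real.exp (c * t)) (c ^ 2 * Real.exp (c * t)) t := by
    simpa [sq, mul_assoc] using (hd t).const_mul c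
  exact lap_comp (F := fun t => Real.exp (c * t)) hu (s := univ) (fun _ => mem_univ _)
    (fun t _ => hd t) (fun t _ => hd2 t) x

/-- Pointwise comparison between `-Δ u` and `e^{u/2}`. -/
lemma exp_half_le_neg_lap (hu : ContDiff ℝ (4 : ℕ) u)
    (heq : ∀ x, lap (fun y => lap u y) x = Real.exp (u x))
    (hneg : ∀ x, lap u x ≤ 0) (x : En n) :
    Real.exp (1 / 2 * u x) ≤ -lap u x := by
  have hl : ContDiff ℝ 2 (lap u) := ContDiff.lap hu (by norm_num)
  have hu2 : ContDiff ℝ 2 u := hu.of_le (by norm_num)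
  have hE : ContDiff ℝ 2 (fun y => Real.exp (1 / 2 * u y)) := (contDiff_const.mul hu2).exp
  have hs : Real.sqrt 2 ^ 2 = 2 := Real.sq_sqrt (by norm_num)
  have hs1 : 1 ≤ Real.sqrt 2 := by rw [Real.one_le_sqrt]; norm_num
  have hw : ContDiff ℝ 2 (fun y => Real.sqrt 2 * Real.exp (1 / 2 * u y) + lap u y) :=
    (contDiff_const.mul hE).add hl
  have key := keller_osserman hw (fun y hy => by
    rw [lap_add (contDiff_const.mul hE) hl, lap_const_mul _ hE, lap_exp_mul hu2]
    have h2 : lap (lap u) y = Real.exp (u y) := heq y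
    have h3 : Real.exp (u y) = Real.exp (1 / 2 * u y) ^ 2 := by
      rw [sq, ← Real.exp_add]; ring_nf
    rw [h2, h3]
    set E := Real.exp (1 / 2 * u y)
    have hEp : 0 < E := Real.exp_pos _
    have hL := hneg y
    have hg : 0 ≤ Real.sqrt 2 * ((1 / 2) ^ 2 * E * gradSq u y) := by
      have := gradSq_nonneg u y
      positivity
    set s := Real.sqrt 2
    have h4 : (s * E + lap u y) * (s * E + lap u y) ≤ s * E * (s * E + lap u y) := by
      apply mul_le_mul_of_nonneg_right _ hy.le
      linarith
    nlinarith) x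
  have := Real.exp_pos (1 / 2 * u x)
  nlinarith

end Comparison

section

open scoped SchwartzMap FourierTransform Laplacian LineDeriv

/-- A nonnegative bounded log-convex sequence does not increase at the start. -/
lemma le_of_sq_le_mul_of_bounded {A : ℕ → ℝ} {K : ℝ} (h0 : ∀ k, 0 ≤ A k)
    (hlog : ∀ k, A (k + 1) ^ 2 ≤ A (k + 2) * A k) (hK : ∀ k, A k ≤ K) : A 1 ≤ A 0 := by
  by_contra! hlt
  have hA0 : 0 < A 0 := by
    refine lt_of_le_of_ne (h0 0) fun h => ?_
    have := hlog 0
    rw [← h] at this hlt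
    simp only [zero_add] at this
    nlinarith
  have hr : 1 < A 1 / A 0 := (one_lt_div hA0).2 hlt
  have key : ∀ k, 0 < A k ∧ A 1 / A 0 * A k ≤ A (k + 1) := by
    intro k
    induction k with
    | zero => exact ⟨hA0, by simp [hA0.ne']⟩
    | succ k ih =>
      have hpos : 0 < A (k + 1) := lt_of_lt_of_le (by nlinarith [ih.1]) ih.2
      refine ⟨hpos, ?_⟩
      have := hlog k
      have h1 : A 1 / A 0 * A (k + 1) * A k ≤ A (k + 2) * A k := by nlinarith [ih.2]
      exact le_of_mul_le_mul_right h1 ih.1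
  have hpow : ∀ k, (A 1 / A 0) ^ k * A 0 ≤ A k := by
    intro k
    induction k with
    | zero => simp
    | succ k ih =>
      calc (A 1 / A 0) ^ (k + 1) * A 0 = A 1 / A 0 * ((A 1 / A 0) ^ k * A 0) := by ring
        _ ≤ A 1 / A 0 * A k := by gcongr
        _ ≤ _ := (key k).2
  obtain ⟨k, hk⟩ := pow_unbounded_of_one_lt (K / A 0) hr
  rw [div_lt_iff₀ hA0] at hk
  linarith [hpow k, hK k]

/-- A form of Krein's lemma: an operator that is symmetric for a positive semidefinite form `B`
and contractive for a norm dominating `B` satisfies `B (S f) f ≤ B f f`. -/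
lemma krein {V : Type*} {B : V → V → ℝ} {N : V → ℝ} {S : V → V} {K : ℝ} (hK : 0 ≤ K)
    (hnn : ∀ f, 0 ≤ B f f) (hcs : ∀ f g, B f g ^ 2 ≤ B f f * B g g)
    (hS : ∀ f g, B (S f) g = B f (S g)) (hBN : ∀ f, B f f ≤ K * N f)
    (hN : ∀ f, N (S f) ≤ N f) (f : V) : B (S f) f ≤ B f f := by
  have hA : B (S f) (S f) ≤ B f f := by
    have hNk : ∀ k, N (S^[k] f) ≤ N f := by
      intro k
      induction k with
      | zero => simp
      | succ k ih => rw [Function.iterate_succ_apply']; exact (hN _).trans ih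
    refine le_of_sq_le_mul_of_bounded (A := fun k => B (S^[k] f) (S^[k] f)) (K := K * N f)
      (fun k => hnn _) (fun k => ?_) fun k => (hBN _).trans (by gcongr; exact hNk k)
    have : B (S^[k + 1] f) (S^[k + 1] f) = B (S^[k + 2] f) (S^[k] f) := by
      rw [Function.iterate_succ_apply' S (k + 1), hS, ← Function.iterate_succ_apply' S k]
    rw [this]
    exact hcs _ _
  have := hcs (S f) f
  have h2 : B (S f) f ^ 2 ≤ B f f ^ 2 := this.trans (by nlinarith [hnn f])
  exact abs_le_of_sq_le_sq' h2 (hnn f) |>.2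

section Multiplier

variable {n : ℕ} {c κ : ℝ}

/-- The symbol `(c + 4π²κ|ξ|²)^r` of `(c - κΔ)^r`. -/
def resSymb (n : ℕ) (c κ r : ℝ) (ξ : En n) : ℝ := (c + κ * (2 * Real.pi) ^ 2 * ‖ξ‖ ^ 2) ^ r

lemma resSymb_base_pos (hc : 0 < c) (hκ : 0 ≤ κ) (ξ : En n) :
    0 < c + κ * (2 * Real.pi) ^ 2 * ‖ξ‖ ^ 2 := by positivity

lemma resSymb_temperate (hc : 0 < c) (hκ : 0 ≤ κ) (r : ℝ) :
    (resSymb n c κ r).HasTemperateGrowth := by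
  set t : ℝ := Real.sqrt (κ / c) * (2 * Real.pi)
  have h1 : (fun ξ : En n => t • ξ).HasTemperateGrowth := by fun_prop
  have h2 := (Function.hasTemperateGrowth_one_add_norm_sq_rpow (En n) r).comp h1
  have h3 : (fun ξ : En n => c ^ r * (1 + ‖t • ξ‖ ^ 2) ^ r).HasTemperateGrowth :=
    (Function.HasTemperateGrowth.const (c ^ r)).mul h2
  convert h3 using 2 with ξ
  rw [resSymb, ← Real.mul_rpow hc.le (by positivity)]
  congr 1
  rw [norm_smul, mul_pow ‖t‖, Real.norm_eq_abs, sq_abs, mul_pow (Real.sqrt _), Real.sq_sqrt (by positivity)]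
  field_simp

/-- The operator `(c - κΔ)^r` on complex Schwartz functions. -/
def resOp (n : ℕ) (c κ r : ℝ) : 𝓢(En n, ℂ) →L[ℝ] 𝓢(En n, ℂ) :=
  SchwartzMap.fourierMultiplierCLM ℂ (resSymb n c κ r)

lemma resOp_resOp (hc : 0 < c) (hκ : 0 ≤ κ) (r s : ℝ) (f : 𝓢(En n, ℂ)) :
    resOp n c κ r (resOp n c κ s f) = resOp n c κ (r + s) f := by
  rw [resOp, resOp, SchwartzMap.fourierMultiplierCLM_fourierMultiplierCLM_apply
    (resSymb_temperate hc hκ r) (resSymb_temperate hc hκ s)]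
  congr 2
  ext ξ
  exact (Real.rpow_add (resSymb_base_pos hc hκ ξ) r s).symm

lemma resOp_zero (f : 𝓢(En n, ℂ)) : resOp n c κ 0 f = f := by
  have : resSymb n c κ 0 = fun _ => 1 := by ext; simp [resSymb]
  rw [resOp, this]
  simp

lemma resOp_one (f : 𝓢(En n, ℂ)) : resOp n c κ 1 f = c • f - κ • Δ f := by
  have : resSymb n c κ 1 = (fun _ => c) + (κ * (2 * Real.pi) ^ 2) • (‖·‖ ^ 2 : En n → ℝ) := by
    ext; simp [resSymb]
  have h2 : (‖·‖ ^ 2 : En n → ℝ).HasTemperateGrowth := by fun_prop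
  rw [SchwartzMap.laplacian_eq_fourierMultiplierCLM, resOp, this]
  simp only [SchwartzMap.fourierMultiplierCLM_apply]
  rw [SchwartzMap.smulLeftCLM_add (by fun_prop) (by fun_prop), SchwartzMap.smulLeftCLM_smul h2]
  have h3 : SchwartzMap.smulLeftCLM ℂ (fun _ : En n => c) (𝓕 f) = c • 𝓕 f := by simp
  rw [_root_.add_apply, _root_.smul_apply, h3, FourierTransform.fourierInv_add,
    FourierTransform.fourierInv_smul, FourierTransform.fourierInv_smul,
    FourierTransform.fourierInv_fourier_eq, smul_smul]
  rw [sub_eq_add_neg, ← neg_smul]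
  congr 2
  ring

/-- The real `L²` pairing of complex Schwartz functions. -/
def ip (f g : 𝓢(En n, ℂ)) : ℝ := ∫ x, (inner ℂ (f x) (g x)).re

lemma integrable_inner (f g : 𝓢(En n, ℂ)) : Integrable fun x => inner ℂ (f x) (g x) := by
  refine (L2.integrable_inner (𝕜 := ℂ) (f.toLp 2 volume) (g.toLp 2 volume)).congr ?_
  filter_upwards [f.coeFn_toLp 2 volume, g.coeFn_toLp 2 volume] with x hf hg
  rw [hf, hg]

lemma ip_eq (f g : 𝓢(En n, ℂ)) :
    ip f g = (inner ℂ (f.toLp 2 volume) (g.toLp 2 volume)).re := by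
  rw [SchwartzMap.inner_toL2_toL2_eq f g volume]
  exact integral_re (integrable_inner f g)

lemma ip_fourier (f g : 𝓢(En n, ℂ)) : ip (𝓕 f) (𝓕 g) = ip f g := by
  rw [ip_eq, ip_eq, SchwartzMap.inner_fourier_toL2_eq]

lemma ip_self (f : 𝓢(En n, ℂ)) : ip f f = ∫ x, ‖f x‖ ^ 2 := by
  refine integral_congr_ae (.of_forall fun x => ?_)
  simp only [inner_self_eq_norm_sq_to_K]
  norm_cast

lemma ip_self_nonneg (f : 𝓢(En n, ℂ)) : 0 ≤ ip f f := by
  rw [ip_self]; positivity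

lemma ip_sq_le (f g : 𝓢(En n, ℂ)) : ip f g ^ 2 ≤ ip f f * ip g g := by
  have h (f : 𝓢(En n, ℂ)) : ip f f = ‖f.toLp 2 volume‖ ^ 2 := by
    rw [ip_eq, inner_self_eq_norm_sq_to_K]; norm_cast
  rw [h, h, ip_eq, ← mul_pow, sq_le_sq, abs_of_nonneg (a := _ * _) (by positivity)]
  exact (Complex.abs_re_le_norm _).trans (norm_inner_le_norm _ _)

lemma ip_smulLeft {b : En n → ℝ} (hb : b.HasTemperateGrowth) (f g : 𝓢(En n, ℂ)) :
    ip (SchwartzMap.smulLeftCLM ℂ b f) g = ip f (SchwartzMap.smulLeftCLM ℂ b g) := by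
  refine integral_congr_ae (.of_forall fun x => ?_)
  simp only [SchwartzMap.smulLeftCLM_apply_apply hb, inner_smul_left_eq_smul,
    inner_smul_right_eq_smul]

lemma fourier_resOp (r : ℝ) (f : 𝓢(En n, ℂ)) :
    𝓕 (resOp n c κ r f) = SchwartzMap.smulLeftCLM ℂ (resSymb n c κ r) (𝓕 f) := by
  rw [resOp, SchwartzMap.fourierMultiplierCLM_apply, FourierTransform.fourier_fourierInv_eq]

lemma ip_resOp (hc : 0 < c) (hκ : 0 ≤ κ) (r : ℝ) (f g : 𝓢(En n, ℂ)) :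
    ip (resOp n c κ r f) g = ip f (resOp n c κ r g) := by
  rw [← ip_fourier, ← ip_fourier f, fourier_resOp, fourier_resOp,
    ip_smulLeft (resSymb_temperate hc hκ r)]

lemma ip_resOp_le (hc : 0 < c) (hκ : 0 ≤ κ) (f : 𝓢(En n, ℂ)) :
    ip (resOp n c κ (-1 / 2) f) (resOp n c κ (-1 / 2) f) ≤ (c ^ (-1 / 2 : ℝ)) ^ 2 * ip f f := by
  rw [← ip_fourier, ← ip_fourier f, fourier_resOp, ip_self, ip_self, ← integral_const_mul]
  have hi (f : 𝓢(En n, ℂ)) : Integrable fun x => ‖f x‖ ^ 2 := by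
    refine (integrable_inner f f).re.congr (.of_forall fun x => ?_)
    simp only [inner_self_eq_norm_sq_to_K]
    norm_cast
  refine integral_mono (hi _) ((hi _).const_mul _) fun x => ?_
  dsimp only
  rw [SchwartzMap.smulLeftCLM_apply_apply (resSymb_temperate hc hκ _), norm_smul, mul_pow,
    Real.norm_of_nonneg (show 0 ≤ resSymb n c κ (-1 / 2) x from
      Real.rpow_nonneg (resSymb_base_pos hc hκ x).le _)]
  gcongr
  · exact Real.rpow_nonneg (resSymb_base_pos hc hκ x).le _
  · exact Real.rpow_le_rpow_of_nonpos hc (le_add_of_nonneg_right (by positivity)) (by norm_num)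

lemma heinz_ip (hc : 0 < c) (hκ : 0 ≤ κ) {b : En n → ℝ} (hb : b.HasTemperateGrowth)
    (h : ∀ f : 𝓢(En n, ℂ), ip (SchwartzMap.smulLeftCLM ℂ b f) (SchwartzMap.smulLeftCLM ℂ b f) ≤
      ip (resOp n c κ 1 f) (resOp n c κ 1 f)) (f : 𝓢(En n, ℂ)) :
    ip (SchwartzMap.smulLeftCLM ℂ b f) f ≤ ip (resOp n c κ 1 f) f := by
  have hH (f g : 𝓢(En n, ℂ)) :
      ip (resOp n c κ (-1 / 2) f) (resOp n c κ (-1 / 2) g) = ip f (resOp n c κ (-1) g) := by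
    rw [ip_resOp hc hκ, resOp_resOp hc hκ]
    norm_num
  have h1 (f : 𝓢(En n, ℂ)) : resOp n c κ (-1) (resOp n c κ 1 f) = f := by
    rw [resOp_resOp hc hκ]; norm_num [resOp_zero]
  have h1' (f : 𝓢(En n, ℂ)) : resOp n c κ 1 (resOp n c κ (-1) f) = f := by
    rw [resOp_resOp hc hκ]; norm_num [resOp_zero]
  have := krein (V := 𝓢(En n, ℂ))
    (B := fun f g => ip (resOp n c κ (-1 / 2) f) (resOp n c κ (-1 / 2) g)) (N := fun f => ip f f)
    (S := fun f => SchwartzMap.smulLeftCLM ℂ b (resOp n c κ (-1) f))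
    (K := (c ^ (-1 / 2 : ℝ)) ^ 2) (by positivity)
    (fun f => ip_self_nonneg _) (fun f g => ip_sq_le _ _)
    (fun f g => by
      rw [hH, ip_smulLeft hb, hH, ← ip_resOp hc hκ]) (ip_resOp_le hc hκ)
    (fun f => by
      have := h (resOp n c κ (-1) f)
      rwa [h1'] at this) (resOp n c κ 1 f)
  rwa [hH, hH, h1] at this

lemma lap_clm_comp (L : ℂ →L[ℝ] ℝ) (f : 𝓢(En n, ℂ)) (x : En n) :
    lap (fun y => L (f y)) x = L (Δ f x) := by
  have h1 (g : 𝓢(En n, ℂ)) (i : Fin n) :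
      pd i (fun y => L (g y)) = fun y => L (∂_{EuclideanSpace.single i (1 : ℝ)} g y) := by
    ext y
    have hd : HasFDerivAt (fun y => L (g y)) (L ∘L fderiv ℝ g y) y :=
      (L.hasFDerivAt (x := g y)).comp y g.differentiableAt.hasFDerivAt
    rw [pd, SchwartzMap.lineDerivOp_apply_eq_fderiv, hd.fderiv]
    rfl
  rw [lap_eq_sum, SchwartzMap.laplacian_eq_sum (EuclideanSpace.basisFun (Fin n) ℝ),
    sum_apply, map_sum]
  refine Finset.sum_congr rfl fun i _ => ?_
  rw [h1, h1]
  simp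

lemma norm_sq_eq_re_im (z : ℂ) : ‖z‖ ^ 2 = z.re ^ 2 + z.im ^ 2 := by
  rw [Complex.sq_norm, Complex.normSq_apply]; ring

lemma integrable_re_im_sq (f : 𝓢(En n, ℂ)) :
    Integrable (fun x => (f x).re ^ 2) ∧ Integrable fun x => (f x).im ^ 2 := by
  have h : Integrable fun x => ‖f x‖ ^ 2 := by
    refine (integrable_inner f f).re.congr (.of_forall fun x => ?_)
    simp only [inner_self_eq_norm_sq_to_K]
    norm_cast
  constructor
  · refine h.mono' (by fun_prop) (.of_forall fun x => ?_)
    rw [norm_sq_eq_re_im, Real.norm_of_nonneg (sq_nonneg _)]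
    nlinarith [sq_nonneg (f x).im]
  · refine h.mono' (by fun_prop) (.of_forall fun x => ?_)
    rw [norm_sq_eq_re_im, Real.norm_of_nonneg (sq_nonneg _)]
    nlinarith [sq_nonneg (f x).re]

lemma ip_self_eq_re_im (f : 𝓢(En n, ℂ)) :
    ip f f = (∫ x, (f x).re ^ 2) + ∫ x, (f x).im ^ 2 := by
  rw [ip_self, ← integral_add (integrable_re_im_sq f).1 (integrable_re_im_sq f).2]
  simp only [norm_sq_eq_re_im]

/-- Heinz inequality: `b² ≤ (c - κΔ)²` in the form sense implies `b ≤ c - κΔ`. -/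
theorem heinz (hc : 0 < c) (hκ : 0 ≤ κ) {b : En n → ℝ} (hb : b.HasTemperateGrowth)
    (h : ∀ ψ : 𝓢(En n, ℝ), ∫ x, (b x * ψ x) ^ 2 ≤ ∫ x, (c * ψ x - κ * lap ψ x) ^ 2)
    (φ : 𝓢(En n, ℝ)) : ∫ x, b x * φ x ^ 2 ≤ ∫ x, (c * φ x - κ * lap φ x) * φ x := by
  have hre (f : 𝓢(En n, ℂ)) (x : En n) : lap (fun y => (f y).re) x = (Δ f x).re :=
    lap_clm_comp Complex.reCLM f x
  have him (f : 𝓢(En n, ℂ)) (x : En n) : lap (fun y => (f y).im) x = (Δ f x).im :=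
    lap_clm_comp Complex.imCLM f x
  have key := heinz_ip hc hκ hb (fun f => by
    rw [ip_self_eq_re_im, ip_self_eq_re_im]
    refine add_le_add ?_ ?_
    · refine (le_of_eq ?_).trans ((h (SchwartzMap.postcompCLM Complex.reCLM f)).trans
        (le_of_eq ?_)) <;> refine integral_congr_ae (.of_forall fun x => ?_)
      · simp [SchwartzMap.smulLeftCLM_apply_apply hb]
      · have : lap (SchwartzMap.postcompCLM Complex.reCLM f) x = (Δ f x).re := hre f x
        simp [resOp_one, this]
    · refine (le_of_eq ?_).trans ((h (SchwartzMap.postcompCLM Complex.imCLM f)).trans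
        (le_of_eq ?_)) <;> refine integral_congr_ae (.of_forall fun x => ?_)
      · simp [SchwartzMap.smulLeftCLM_apply_apply hb]
      · have : lap (SchwartzMap.postcompCLM Complex.imCLM f) x = (Δ f x).im := him f x
        simp [resOp_one, this])
    (SchwartzMap.postcompCLM Complex.ofRealCLM φ)
  set F := SchwartzMap.postcompCLM Complex.ofRealCLM φ with hF
  have hFx (x : En n) : F x = φ x := rfl
  have hΔ (x : En n) : (Δ F x).re = lap φ x := by
    rw [← hre]; simp only [hFx, Complex.ofReal_re]
  convert key using 1
  · refine integral_congr_ae (.of_forall fun x => ?_)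
    simp [SchwartzMap.smulLeftCLM_apply_apply hb, hFx]
    ring
  · refine integral_congr_ae (.of_forall fun x => ?_)
    rw [resOp_one]
    simp [hFx, hΔ]
    ring

end Multiplier

end

section

open scoped SchwartzMap FourierTransform Laplacian LineDeriv Convolution ContDiff

section Mollify

variable {n : ℕ} {g φ : En n → ℝ} {δ : ℝ}

/-- Mollification of `g` at scale `t`. -/
def moll {t : ℝ} (ht : 0 < t) (g : En n → ℝ) : En n → ℝ :=
  ((⟨t / 2, t, by positivity, by linarith⟩ : ContDiffBump (0 : En n)).normed volume)
    ⋆[ContinuousLinearMap.lsmul ℝ ℝ, volume] g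

lemma contDiff_moll {t : ℝ} (ht : 0 < t) (hg : Continuous g) : ContDiff ℝ ∞ (moll ht g) :=
  HasCompactSupport.contDiff_convolution_left _ (ContDiffBump.hasCompactSupport_normed _)
    (ContDiffBump.contDiff_normed _) hg.locallyIntegrable

lemma moll_eq_zero {t : ℝ} (ht : 0 < t) {x : En n} (hx : x ∉ cthickening t (tsupport g)) :
    moll ht g x = 0 := by
  by_contra h
  have h1 := support_convolution_subset (μ := volume) (ContinuousLinearMap.lsmul ℝ ℝ) h
  rw [ContDiffBump.support_normed_eq] at h1
  obtain ⟨y, hy, z, hz, rfl⟩ := h1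
  refine hx (mem_cthickening_of_dist_le _ z t _ (subset_tsupport _ hz) ?_)
  have := mem_ball_zero_iff.1 hy
  simpa using this.le

lemma exists_moll_close (hg : Continuous g) (hc : HasCompactSupport g) (hδ : 0 < δ) :
    ∃ t₀ > 0, ∀ t (ht : 0 < t), t ≤ t₀ → ∀ x, |moll ht g x - g x| ≤ δ := by
  obtain ⟨t₀, ht₀, h⟩ := Metric.uniformContinuous_iff.1
    (hc.uniformContinuous_of_continuous hg) δ hδ
  refine ⟨t₀, ht₀, fun t ht htt x => ?_⟩
  rw [← Real.dist_eq]
  refine ContDiffBump.dist_normed_convolution_le hg.aestronglyMeasurable fun y hy => ?_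
  exact (h (lt_of_lt_of_le hy htt)).le

lemma pd_moll {t : ℝ} (ht : 0 < t) (hg : ContDiff ℝ 1 g) (hc : HasCompactSupport g) (i : Fin n) :
    pd i (moll ht g) = moll ht (pd i g) := by
  ext x
  have := hc.hasFDerivAt_convolution_right (ContinuousLinearMap.lsmul ℝ ℝ) (μ := volume)
    (((⟨t / 2, t, by positivity, by linarith⟩ : ContDiffBump (0 : En n)).continuous_normed
      (μ := volume)).locallyIntegrable) hg x
  rw [pd, moll, this.fderiv, convolution_precompR_apply _
    (ContDiffBump.continuous_normed _).locallyIntegrable (hc.fderiv ℝ)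
    (hg.continuous_fderiv one_ne_zero)]
  rfl

/-- Uniform approximation of a compactly supported continuous function by test functions. -/
lemma exists_smooth_close (hg : Continuous g) (hc : HasCompactSupport g) (hδ : 0 < δ) :
    ∃ ψ : En n → ℝ, ContDiff ℝ ∞ ψ ∧ HasCompactSupport ψ ∧ ∀ x, |ψ x - g x| ≤ δ := by
  obtain ⟨t₀, ht₀, h⟩ := exists_moll_close hg hc hδ
  exact ⟨moll ht₀ g, contDiff_moll _ hg,
    HasCompactSupport.intro (hc.isCompact.cthickening (r := t₀)) fun x hx => moll_eq_zero _ hx,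
    h t₀ ht₀ le_rfl⟩

/-- `C¹` approximation of a compactly supported `C¹` function by test functions. -/
lemma exists_smooth_close_C1 (hg : ContDiff ℝ 1 g) (hc : HasCompactSupport g) (hδ : 0 < δ) :
    ∃ ψ : En n → ℝ, ContDiff ℝ ∞ ψ ∧ HasCompactSupport ψ ∧
      (∀ x ∉ cthickening 1 (tsupport g), ψ x = 0 ∧ ∀ i, pd i ψ x = 0) ∧
      (∀ x, |ψ x - g x| ≤ δ) ∧ ∀ i x, |pd i ψ x - pd i g x| ≤ δ := by
  obtain ⟨t₀, ht₀, h⟩ := exists_moll_close hg.continuous hc hδ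
  choose t hpos ht using fun i : Fin n =>
    exists_moll_close (hg.continuous_pd i) (HasCompactSupport.pd hc i) hδ
  obtain ⟨s, hs, hs1, hs0, hsi⟩ : ∃ s > 0, s ≤ 1 ∧ s ≤ t₀ ∧ ∀ i, s ≤ t i := by
    have : ∀ᶠ s : ℝ in nhdsWithin 0 (Ioi 0), 0 < s ∧ s ≤ 1 ∧ s ≤ t₀ ∧ ∀ i, s ≤ t i := by
      have hlt (a : ℝ) (ha : 0 < a) : ∀ᶠ s : ℝ in nhdsWithin 0 (Ioi 0), s ≤ a :=
        nhdsWithin_le_nhds (Iic_mem_nhds ha)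
      filter_upwards [self_mem_nhdsWithin, hlt 1 one_pos, hlt t₀ ht₀,
        eventually_all.2 fun i => hlt (t i) (hpos i)] with s h1 h2 h3 h4
      exact ⟨h1, h2, h3, h4⟩
    obtain ⟨s, h1, h2⟩ := this.exists
    exact ⟨s, h1, h2⟩
  have hsub (f : En n → ℝ) : cthickening s (tsupport f) ⊆ cthickening 1 (tsupport f) :=
    cthickening_mono hs1 _
  refine ⟨moll hs g, contDiff_moll _ hg.continuous,
    HasCompactSupport.intro (hc.isCompact.cthickening (r := s)) fun x hx => moll_eq_zero _ hx,
    fun x hx => ⟨moll_eq_zero _ fun h => hx (hsub g h), fun i => ?_⟩, h s hs hs0, fun i x => ?_⟩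
  · rw [pd_moll hs hg hc]
    refine moll_eq_zero _ fun h => hx ?_
    exact cthickening_subset_of_subset _ (tsupport_pd_subset i) (hsub _ h)
  · rw [pd_moll hs hg hc]
    exact ht i s hs (hsi i) x

/-- Convergence of weighted `L²` norms under uniform convergence with common compact support. -/
lemma tendsto_integral_sq_of_close {w f : En n → ℝ} {F : ℕ → En n → ℝ} {K : Set (En n)}
    (hK : IsCompact K) (hw : Continuous w) (hf : Continuous f) (hF : ∀ k, Continuous (F k))
    (hF0 : ∀ k, ∀ x ∉ K, F k x = 0)
    (hclose : ∀ k x, |F k x - f x| ≤ 1 / ((k : ℝ) + 1)) :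
    Tendsto (fun k => ∫ x, w x * F k x ^ 2) atTop (nhds (∫ x, w x * f x ^ 2)) := by
  refine tendsto_integral_of_dominated_convergence
    (K.indicator fun x => |w x| * (|f x| + 1) ^ 2)
    (fun k => (hw.mul ((hF k).pow 2)).aestronglyMeasurable) ?_ (fun k => .of_forall fun x => ?_)
    (.of_forall fun x => ?_)
  · exact (ContinuousOn.integrableOn_compact hK (by fun_prop)).integrable_indicator
      hK.measurableSet
  · by_cases hx : x ∈ K
    · rw [indicator_of_mem hx, norm_mul, norm_pow, Real.norm_eq_abs, Real.norm_eq_abs]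
      gcongr
      have h1 : 1 / ((k : ℝ) + 1) ≤ 1 := by
        rw [div_le_one (by positivity)]; linarith [(Nat.cast_nonneg k : (0:ℝ) ≤ k)]
      have h2 := abs_sub_abs_le_abs_sub (F k x) (f x)
      linarith [hclose k x]
    · simp [hF0 k x hx, hx]
  · have : Tendsto (fun k => F k x) atTop (nhds (f x)) := by
      rw [tendsto_iff_dist_tendsto_zero]
      exact squeeze_zero (fun _ => dist_nonneg) (fun k => by rw [Real.dist_eq]; exact hclose k x)
        tendsto_one_div_add_atTop_nhds_zero_nat
    exact (this.pow 2).const_mul _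

end Mollify

section SchwartzReal

variable {n : ℕ}

lemma pd_schwartz (i : Fin n) (ψ : 𝓢(En n, ℝ)) :
    pd i ψ = ⇑(∂_{EuclideanSpace.single i (1 : ℝ)} ψ : 𝓢(En n, ℝ)) := rfl

lemma lap_schwartz (ψ : 𝓢(En n, ℝ)) : lap ψ = ⇑(Δ ψ : 𝓢(En n, ℝ)) := by
  ext x
  rw [lap_eq_sum, SchwartzMap.laplacian_eq_sum (EuclideanSpace.basisFun (Fin n) ℝ), sum_apply]
  refine Finset.sum_congr rfl fun i _ => ?_
  rw [pd_schwartz, pd_schwartz]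
  simp

lemma integrable_schwartz_mul (f g : 𝓢(En n, ℝ)) : Integrable fun x => f x * g x :=
  (f.memLp 2).integrable_mul (g.memLp 2)

lemma integrable_schwartz_sq (f : 𝓢(En n, ℝ)) : Integrable fun x => f x ^ 2 := by
  simpa only [sq] using integrable_schwartz_mul f f

lemma integrable_gradSq_schwartz (ψ : 𝓢(En n, ℝ)) : Integrable (gradSq ψ) := by
  refine integrable_finsetSum _ fun i _ => ?_
  rw [pd_schwartz]
  exact integrable_schwartz_sq _

lemma integral_mul_lap_schwartz (ψ : 𝓢(En n, ℝ)) :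
    ∫ x, ψ x * lap ψ x = -∫ x, gradSq ψ x := by
  have h (i : Fin n) : ∫ x, ψ x * pd i (pd i ψ) x = -∫ x, pd i ψ x ^ 2 := by
    have := SchwartzMap.integral_mul_lineDerivOp_right_eq_neg_left (μ := volume) ψ
      (∂_{EuclideanSpace.single i (1 : ℝ)} ψ) (EuclideanSpace.single i (1 : ℝ))
    simp only [sq]
    exact this
  simp only [lap_eq_sum, gradSq, Finset.mul_sum]
  rw [integral_finsetSum, integral_finsetSum, ← Finset.sum_neg_distrib]
  · exact Finset.sum_congr rfl fun i _ => h i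
  · exact fun i _ => by rw [pd_schwartz]; exact integrable_schwartz_sq _
  · exact fun i _ => by rw [pd_schwartz, pd_schwartz]; exact integrable_schwartz_mul _ _

lemma integral_resolvent_mul (c κ : ℝ) (ψ : 𝓢(En n, ℝ)) :
    ∫ x, (c * ψ x - κ * lap ψ x) * ψ x = c * (∫ x, ψ x ^ 2) + κ * ∫ x, gradSq ψ x := by
  have h := integral_mul_lap_schwartz ψ
  have h1 := integrable_schwartz_sq ψ
  have h2 : Integrable fun x => ψ x * lap ψ x := by
    rw [lap_schwartz]; exact integrable_schwartz_mul _ _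
  calc ∫ x, (c * ψ x - κ * lap ψ x) * ψ x = ∫ x, (c * ψ x ^ 2 - κ * (ψ x * lap ψ x)) := by
        congr 1; ext x; ring
    _ = _ := by
      rw [integral_sub (h1.const_mul c) (h2.const_mul κ), integral_const_mul, integral_const_mul, h]
      ring

lemma integral_resolvent_sq (c κ : ℝ) (ψ : 𝓢(En n, ℝ)) :
    ∫ x, (c * ψ x - κ * lap ψ x) ^ 2 =
      c ^ 2 * (∫ x, ψ x ^ 2) + 2 * c * κ * (∫ x, gradSq ψ x) + κ ^ 2 * ∫ x, lap ψ x ^ 2 := by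
  have h := integral_mul_lap_schwartz ψ
  have h1 := integrable_schwartz_sq ψ
  have h2 : Integrable fun x => ψ x * lap ψ x := by
    rw [lap_schwartz]; exact integrable_schwartz_mul _ _
  have h3 : Integrable fun x => lap ψ x ^ 2 := by
    rw [lap_schwartz]; exact integrable_schwartz_sq _
  calc ∫ x, (c * ψ x - κ * lap ψ x) ^ 2
      = ∫ x, (c ^ 2 * ψ x ^ 2 - 2 * c * κ * (ψ x * lap ψ x) + κ ^ 2 * lap ψ x ^ 2) := by
        congr 1; ext x; ring
    _ = _ := by
      have h12 : Integrable fun x => c ^ 2 * ψ x ^ 2 - 2 * c * κ * (ψ x * lap ψ x) :=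
        (h1.const_mul _).sub (h2.const_mul _)
      rw [integral_add h12 (h3.const_mul _),
        integral_sub (h1.const_mul _) (h2.const_mul _), integral_const_mul, integral_const_mul,
        integral_const_mul, h]
      ring

end SchwartzReal

end

section

open scoped SchwartzMap ContDiff

lemma add_sq_le_young {ε : ℝ} (hε : 0 < ε) (a b : ℝ) :
    (a + b) ^ 2 ≤ (1 + ε) * a ^ 2 + (1 + 1 / ε) * b ^ 2 := by
  have h : (1 + ε) * a ^ 2 + (1 + 1 / ε) * b ^ 2 - (a + b) ^ 2 = (ε * a - b) ^ 2 / ε := by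
    field_simp; ring
  have : 0 ≤ (ε * a - b) ^ 2 / ε := by positivity
  linarith

lemma HasCompactSupport.gradSq {n : ℕ} {f : En n → ℝ} (hf : HasCompactSupport f) :
    HasCompactSupport (_root_.gradSq f) := by
  refine HasCompactSupport.intro (K := tsupport f) hf fun x hx => ?_
  refine Finset.sum_eq_zero fun i _ => ?_
  rw [image_eq_zero_of_notMem_tsupport fun h => hx (tsupport_pd_subset i h)]
  ring

section Stab

variable {n : ℕ}

/-- The fourth-order stability inequality for test functions cut off by `χ`. -/
lemma Stable4OutsideBall.cutoff {u χ : En n → ℝ} {ε M R' : ℝ} (hε : 0 < ε)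
    (hst : Stable4OutsideBall n u R') (hχ : ContDiff ℝ ∞ χ)
    (hχc : HasCompactSupport χ) (h01 : ∀ x, 0 ≤ χ x ∧ χ x ≤ 1)
    (hM : ∀ x, |lap χ x| ≤ M) (hM' : ∀ x, gradSq χ x ≤ M) (hsupp : tsupport χ ⊆ (closedBall 0 R')ᶜ)
    (ψ : 𝓢(En n, ℝ)) :
    ∫ x, Real.exp (u x) * (χ x * ψ x) ^ 2 ≤ (1 + ε) * (∫ x, lap ψ x ^ 2) +
      (1 + 1 / ε) * (8 * M * (∫ x, gradSq ψ x) + 2 * M ^ 2 * ∫ x, ψ x ^ 2) := by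
  have h1 := integrable_schwartz_sq ψ
  have h2 := integrable_gradSq_schwartz ψ
  have h3 : Integrable fun x => lap ψ x ^ 2 := by
    rw [lap_schwartz]; exact integrable_schwartz_sq _
  have hψ : ContDiff ℝ ∞ ψ := ψ.smooth ⊤
  have htest : TestOn n (closedBall (0 : En n) R')ᶜ fun x => χ x * ψ x :=
    ⟨hχ.mul hψ, hχc.mul_right, (tsupport_mul_subset_left).trans hsupp⟩
  have hp : 0 ≤ 1 + 1 / ε := by positivity
  refine (hst _ htest).trans ?_
  have hi : Integrable fun x => 8 * M * gradSq ψ x + 2 * M ^ 2 * ψ x ^ 2 :=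
    (h2.const_mul _).add (h1.const_mul _)
  have hrhs : (1 + ε) * (∫ x, lap ψ x ^ 2) +
      (1 + 1 / ε) * (8 * M * (∫ x, gradSq ψ x) + 2 * M ^ 2 * ∫ x, ψ x ^ 2) =
      ∫ x, ((1 + ε) * lap ψ x ^ 2 + (1 + 1 / ε) * (8 * M * gradSq ψ x + 2 * M ^ 2 * ψ x ^ 2)) := by
    rw [integral_add (h3.const_mul _) (hi.const_mul _), integral_const_mul, integral_const_mul,
      integral_add (h2.const_mul _) (h1.const_mul _), integral_const_mul, integral_const_mul]
  rw [hrhs]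
  have hχ2 : ContDiff ℝ 2 χ := contDiff_infty.1 hχ 2
  have hψ2 : ContDiff ℝ 2 ψ := contDiff_infty.1 hψ 2
  refine integral_mono_of_nonneg (.of_forall fun x => sq_nonneg _)
    ((h3.const_mul _).add (hi.const_mul _)) (.of_forall fun x => ?_)
  dsimp only
  rw [lap_mul hχ2 hψ2, add_assoc]
  refine (add_sq_le_young hε _ _).trans ?_
  have hM0 : 0 ≤ M := (abs_nonneg _).trans (hM x)
  have hX : (∑ i, pd i χ x * pd i ψ x) ^ 2 ≤ gradSq χ x * gradSq ψ x :=
    Finset.sum_mul_sq_le_sq_mul_sq _ _ _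
  have hX' : (∑ i, pd i χ x * pd i ψ x) ^ 2 ≤ M * gradSq ψ x :=
    hX.trans (mul_le_mul_of_nonneg_right (hM' x) (gradSq_nonneg ψ x))
  have hL : (lap χ x) ^ 2 ≤ M ^ 2 := sq_le_sq' (by linarith [neg_abs_le (lap χ x), hM x])
    (by linarith [le_abs_self (lap χ x), hM x])
  have hc2 : χ x ^ 2 ≤ 1 := by nlinarith [h01 x]
  refine add_le_add ?_ (mul_le_mul_of_nonneg_left ?_ hp)
  · refine mul_le_mul_of_nonneg_left ?_ (by positivity)
    nlinarith [sq_nonneg (lap ψ x)]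
  · nlinarith [sq_nonneg (lap χ x * ψ x - 2 * ∑ i, pd i χ x * pd i ψ x),
      mul_le_mul_of_nonneg_right hL (sq_nonneg (ψ x))]

/-- Quadratic form bounds on Schwartz functions extend to compactly supported `C¹` functions. -/
lemma form_bound_of_schwartz {w : En n → ℝ} {κ c : ℝ} (hg : Continuous w)
    (key : ∀ ψ : 𝓢(En n, ℝ), ∫ x, w x * ψ x ^ 2 ≤ κ * (∫ x, gradSq ψ x) + c * ∫ x, ψ x ^ 2)
    {φ : En n → ℝ} (hφ : ContDiff ℝ 1 φ) (hφc : HasCompactSupport φ) :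
    ∫ x, w x * φ x ^ 2 ≤ κ * (∫ x, gradSq φ x) + c * ∫ x, φ x ^ 2 := by
  choose ψ hψ hψc hψ0 hψf hψp using fun k : ℕ =>
    exists_smooth_close_C1 hφ hφc (Nat.one_div_pos_of_nat (α := ℝ) (n := k))
  have hK' : IsCompact (cthickening 1 (tsupport φ)) := hφc.isCompact.cthickening
  have t1 := tendsto_integral_sq_of_close hK' hg hφ.continuous (fun k => (hψ k).continuous)
    (fun k x hx => (hψ0 k x hx).1) hψf
  have t2 := tendsto_integral_sq_of_close hK' (w := fun _ => 1) continuous_const hφ.continuous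
    (fun k => (hψ k).continuous) (fun k x hx => (hψ0 k x hx).1) hψf
  have hψ1 (k : ℕ) : ContDiff ℝ 1 (ψ k) := (hψ k).of_le (by exact_mod_cast le_top)
  have t3 (i : Fin n) := tendsto_integral_sq_of_close hK' (w := fun _ => 1) continuous_const
    (hφ.continuous_pd i) (fun k => (hψ1 k).continuous_pd i)
    (fun k x hx => (hψ0 k x hx).2 i) (fun k => hψp k i)
  have hgrad (f : En n → ℝ) (hf : ContDiff ℝ 1 f) (hfc : HasCompactSupport f) :
      ∫ x, gradSq f x = ∑ i, ∫ x, 1 * pd i f x ^ 2 := by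
    simp only [one_mul, gradSq]
    rw [integral_finsetSum]
    intro i _
    simp only [sq]
    exact ((hf.continuous_pd i).mul (hf.continuous_pd i)).integrable_of_hasCompactSupport
      (HasCompactSupport.pd hfc i).mul_left
  have t4 : Tendsto (fun k => ∫ x, gradSq (ψ k) x) atTop (nhds (∫ x, gradSq φ x)) := by
    have t5 := tendsto_finsetSum Finset.univ fun i _ => t3 i
    rw [← hgrad φ hφ hφc] at t5
    refine t5.congr fun k => ?_
    exact (hgrad (ψ k) (hψ1 k) (hψc k)).symm
  simp only [one_mul] at t2
  refine le_of_tendsto_of_tendsto' t1 ((t4.const_mul κ).add (t2.const_mul c)) fun k => ?_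
  exact key ((hψc k).toSchwartzMap (hψ k))

/-- Second-order stability deduced from fourth-order stability. -/
theorem stable_second_order {χ : En n → ℝ} {ε : ℝ} (hε : 0 < ε) (hχ : ContDiff ℝ ∞ χ)
    (hχc : HasCompactSupport χ) (h01 : ∀ x, 0 ≤ χ x ∧ χ x ≤ 1) :
    ∃ C, 0 ≤ C ∧ ∀ (u : En n → ℝ) (R' : ℝ), Continuous u → Stable4OutsideBall n u R' →
      tsupport χ ⊆ (closedBall 0 R')ᶜ → ∀ φ : En n → ℝ, ContDiff ℝ 1 φ → HasCompactSupport φ →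
        ∫ x, Real.exp (1 / 2 * u x) * χ x * φ x ^ 2 ≤
          (1 + ε) * (∫ x, gradSq φ x) + C * ∫ x, φ x ^ 2 := by
  have hχ2 : ContDiff ℝ 2 χ := contDiff_infty.1 hχ 2
  obtain ⟨M₁, hM₁⟩ := (HasCompactSupport.lap hχc).exists_bound_of_continuous
    (ContDiff.continuous_lap hχ2)
  obtain ⟨M₂, hM₂⟩ := (HasCompactSupport.gradSq hχc).exists_bound_of_continuous
    (ContDiff.continuous_gradSq (hχ.of_le (by exact_mod_cast le_top)))
  set M := max M₁ M₂
  have hM : ∀ x, |lap χ x| ≤ M := fun x => (hM₁ x).trans (le_max_left _ _)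
  have hM' : ∀ x, gradSq χ x ≤ M := fun x =>
    (le_abs_self _).trans ((hM₂ x).trans (le_max_right _ _))
  have hM0 : 0 ≤ M := (abs_nonneg _).trans (hM 0)
  set K := 1 + 1 / ε
  have hK : 0 < K := by positivity
  set c := (1 + ε) * K * (8 * M + 2 * M ^ 2) + K + 1
  have hc : 1 ≤ c := by
    have : 0 ≤ (1 + ε) * K * (8 * M + 2 * M ^ 2) := by positivity
    simp only [c]; linarith
  refine ⟨c + 1, by linarith, fun u R' hu hst hsupp φ hφ hφc => ?_⟩
  have hg : Continuous fun x => Real.exp (1 / 2 * u x) * χ x := by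
    have := hχ.continuous; fun_prop
  have hgc : HasCompactSupport fun x => Real.exp (1 / 2 * u x) * χ x := hχc.mul_left
  obtain ⟨b, hb, hbc, hbg⟩ := exists_smooth_close hg hgc one_pos
  have hbt : b.HasTemperateGrowth := hbc.hasTemperateGrowth hb
  have key : ∀ ψ : 𝓢(En n, ℝ), ∫ x, Real.exp (1 / 2 * u x) * χ x * ψ x ^ 2 ≤
      (1 + ε) * (∫ x, gradSq ψ x) + (c + 1) * ∫ x, ψ x ^ 2 := by
    intro ψ
    have hz : ∀ ψ : 𝓢(En n, ℝ),
        ∫ x, (b x * ψ x) ^ 2 ≤ ∫ x, (c * ψ x - (1 + ε) * lap ψ x) ^ 2 := by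
      intro ψ
      have h1 := integrable_schwartz_sq ψ
      have hcut := hst.cutoff hε hχ hχc h01 hM hM' hsupp ψ
      have hI : Integrable fun x => Real.exp (u x) * (χ x * ψ x) ^ 2 := by
        refine Continuous.integrable_of_hasCompactSupport ?_ ?_
        · have := hχ.continuous; have := ψ.continuous; fun_prop
        · exact (hχc.mul_right.comp_left (g := fun t : ℝ => t ^ 2) (by simp)).mul_left
      have hstep : ∫ x, (b x * ψ x) ^ 2 ≤
          (1 + ε) * (∫ x, Real.exp (u x) * (χ x * ψ x) ^ 2) + K * ∫ x, ψ x ^ 2 := by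
        rw [← integral_const_mul, ← integral_const_mul,
          ← integral_add (hI.const_mul _) (h1.const_mul _)]
        refine integral_mono_of_nonneg (.of_forall fun x => sq_nonneg _)
          ((hI.const_mul _).add (h1.const_mul _)) (.of_forall fun x => ?_)
        have he : Real.exp (u x) = Real.exp (1 / 2 * u x) ^ 2 := by
          rw [← Real.exp_nat_mul]; congr 1; push_cast; ring
        have hy := add_sq_le_young hε (Real.exp (1 / 2 * u x) * χ x)
          (b x - Real.exp (1 / 2 * u x) * χ x)
        have hd : (b x - Real.exp (1 / 2 * u x) * χ x) ^ 2 ≤ 1 := by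
          have := hbg x
          rw [← sq_abs]; exact pow_le_one₀ (abs_nonneg _) this
        have hb2 : b x ^ 2 ≤ (1 + ε) * (Real.exp (1 / 2 * u x) * χ x) ^ 2 + K := by
          calc b x ^ 2 = (Real.exp (1 / 2 * u x) * χ x
                + (b x - Real.exp (1 / 2 * u x) * χ x)) ^ 2 := by ring
            _ ≤ _ := hy
            _ ≤ _ := by gcongr; nlinarith
        dsimp only
        rw [he]
        nlinarith [mul_le_mul_of_nonneg_right hb2 (sq_nonneg (ψ x))]
      rw [integral_resolvent_sq]
      have hG : 0 ≤ ∫ x, gradSq ψ x := integral_nonneg fun x => gradSq_nonneg _ x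
      have hP : 0 ≤ ∫ x, ψ x ^ 2 := integral_nonneg fun x => sq_nonneg _
      refine hstep.trans ?_
      have e1 := mul_le_mul_of_nonneg_left hcut (by positivity : 0 ≤ 1 + ε)
      have e2 : (1 + ε) * K * (8 * M) ≤ 2 * c * (1 + ε) := by
        have a1 : (1 + ε) * K * (8 * M) ≤ c := by
          have : 0 ≤ (1 + ε) * K * (2 * M ^ 2) := by positivity
          simp only [c]; linarith
        nlinarith
      have e3 : (1 + ε) * K * (2 * M ^ 2) + K ≤ c ^ 2 := by
        have a1 : (1 + ε) * K * (2 * M ^ 2) + K ≤ c := by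
          have : 0 ≤ (1 + ε) * K * (8 * M) := by positivity
          simp only [c]; linarith
        nlinarith
      have f2 := mul_le_mul_of_nonneg_right e2 hG
      have f3 := mul_le_mul_of_nonneg_right e3 hP
      linarith
    have hh := heinz (by linarith : 0 < c) (by positivity : 0 ≤ 1 + ε) hbt hz ψ
    rw [integral_resolvent_mul] at hh
    have h1 := integrable_schwartz_sq ψ
    have hbi : Integrable fun x => b x * ψ x ^ 2 := by
      have := hb.continuous; have := ψ.continuous
      exact Continuous.integrable_of_hasCompactSupport (by fun_prop) hbc.mul_right
    have hgi : Integrable fun x => Real.exp (1 / 2 * u x) * χ x * ψ x ^ 2 := by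
      have := ψ.continuous
      exact Continuous.integrable_of_hasCompactSupport (hg.mul (by fun_prop)) hgc.mul_right
    have : ∫ x, Real.exp (1 / 2 * u x) * χ x * ψ x ^ 2 ≤
        ∫ x, (b x * ψ x ^ 2 + ψ x ^ 2) := by
      refine integral_mono hgi (hbi.add h1) fun x => ?_
      have := (abs_le.1 (hbg x)).1
      dsimp only
      nlinarith [sq_nonneg (ψ x)]
    rw [integral_add hbi h1] at this
    linarith
  exact form_bound_of_schwartz hg key hφ hφc

end Stab

end

section

open scoped ContDiff NNReal ENNReal

section Energy

variable {n : ℕ} {f A η : En n → ℝ} {κ : ℝ}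

/-- Caccioppoli-type identity for `fη` when `|∇f|² = A + κΔ(f²)`. -/
lemma integral_gradSq_mul (hf : ContDiff ℝ 2 f) (hη : ContDiff ℝ 2 η) (hc : HasCompactSupport η)
    (hA : ∀ x, gradSq f x = A x + κ * lap (fun y => f y ^ 2) x) :
    ∫ x, gradSq (fun y => f y * η y) x = (∫ x, A x * η x ^ 2) +
      ∫ x, f x ^ 2 * (gradSq η x + (κ - 1 / 2) * lap (fun y => η y ^ 2) x) := by
  have hf1 : ContDiff ℝ 1 f := hf.of_le (by norm_num)
  have hη1 : ContDiff ℝ 1 η := hη.of_le (by norm_num)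
  have hc2 : HasCompactSupport fun y => η y ^ 2 := by
    simp only [sq]; exact hc.mul_left
  have hη2 : ContDiff ℝ 2 fun y => η y ^ 2 := hη.pow 2
  have hf2 : ContDiff ℝ 2 fun y => f y ^ 2 := hf.pow 2
  have cA : Continuous A := by
    have : A = fun x => gradSq f x - κ * lap (fun y => f y ^ 2) x := by ext x; rw [hA]; ring
    rw [this]
    exact (ContDiff.continuous_gradSq hf1).sub ((ContDiff.continuous_lap hf2).const_mul κ)
  have hpd2 (g : En n → ℝ) (hg : ContDiff ℝ 1 g) (i : Fin n) (x : En n) :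
      pd i (fun y => g y ^ 2) x = 2 * (g x * pd i g x) := by
    have hd := hg.differentiable (by norm_num)
    simp only [sq]
    rw [pd_mul (f := g) (g := g) hd hd]; ring
  have e1 : ∫ x, f x ^ 2 * lap (fun y => η y ^ 2) x =
      -∫ x, 4 * ∑ i, (f x * pd i f x) * (η x * pd i η x) := by
    rw [integral_mul_lap (hf2.of_le (by norm_num)) hη2 hc2]
    congr 2; ext x
    rw [Finset.mul_sum]
    refine Finset.sum_congr rfl fun i _ => ?_
    rw [hpd2 f hf1, hpd2 η hη1]; ring
  have e2 : ∫ x, lap (fun y => f y ^ 2) x * η x ^ 2 = ∫ x, f x ^ 2 * lap (fun y => η y ^ 2) x :=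
    integral_lap_mul hf2 hη2 hc2
  have iA : Integrable fun x => A x * η x ^ 2 :=
    (cA.mul hη2.continuous).integrable_of_hasCompactSupport hc2.mul_left
  have iL : Integrable fun x => lap (fun y => f y ^ 2) x * η x ^ 2 :=
    ((ContDiff.continuous_lap hf2).mul hη2.continuous).integrable_of_hasCompactSupport hc2.mul_left
  have iG : Integrable fun x => f x ^ 2 * gradSq η x :=
    (hf2.continuous.mul (ContDiff.continuous_gradSq hη1)).integrable_of_hasCompactSupport
      (HasCompactSupport.gradSq hc).mul_left
  have iM : Integrable fun x => f x ^ 2 * lap (fun y => η y ^ 2) x :=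
    (hf2.continuous.mul (ContDiff.continuous_lap hη2)).integrable_of_hasCompactSupport
      (HasCompactSupport.lap hc2).mul_left
  have iX : Integrable fun x => ∑ i, (f x * pd i f x) * (η x * pd i η x) := by
    refine Continuous.integrable_of_hasCompactSupport ?_ ?_
    · exact continuous_finsetSum _ fun i _ => (hf.continuous.mul (hf1.continuous_pd i)).mul
        (hη.continuous.mul (hη1.continuous_pd i))
    · refine HasCompactSupport.intro (K := tsupport η) hc fun x hx => ?_
      exact Finset.sum_eq_zero fun i _ => by rw [image_eq_zero_of_notMem_tsupport hx]; ring
  calc ∫ x, gradSq (fun y => f y * η y) x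
      = ∫ x, ((A x * η x ^ 2 + κ * (lap (fun y => f y ^ 2) x * η x ^ 2)) +
          (f x ^ 2 * gradSq η x + 2 * ∑ i, (f x * pd i f x) * (η x * pd i η x))) := by
        congr 1; ext x
        rw [gradSq_mul (hf1.differentiable (by norm_num)) (hη1.differentiable (by norm_num)), hA]
        ring
    _ = (∫ x, A x * η x ^ 2) + κ * (∫ x, f x ^ 2 * lap (fun y => η y ^ 2) x) +
          ((∫ x, f x ^ 2 * gradSq η x) + 2 * ∫ x, ∑ i, (f x * pd i f x) * (η x * pd i η x)) := by
        have i1 : Integrable fun x => A x * η x ^ 2 + κ * (lap (fun y => f y ^ 2) x * η x ^ 2) :=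
          iA.add (iL.const_mul κ)
        have i2 : Integrable fun x => f x ^ 2 * gradSq η x +
            2 * ∑ i, (f x * pd i f x) * (η x * pd i η x) := iG.add (iX.const_mul 2)
        rw [integral_add i1 i2, integral_add iA (iL.const_mul κ), integral_add iG (iX.const_mul 2),
          integral_const_mul, integral_const_mul, e2]
    _ = _ := by
        have e3 : ∫ x, f x ^ 2 * (gradSq η x + (κ - 1 / 2) * lap (fun y => η y ^ 2) x) =
            (∫ x, f x ^ 2 * gradSq η x) + (κ - 1 / 2) * ∫ x, f x ^ 2 * lap (fun y => η y ^ 2) x := by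
          rw [← integral_const_mul, ← integral_add iG (iM.const_mul _)]
          congr 1; ext x; ring
        rw [integral_const_mul] at e1
        rw [e3]
        linarith

lemma integral_gradSq_mul_le {M : ℝ} {K : Set (En n)} (hf : ContDiff ℝ 2 f) (hη : ContDiff ℝ 2 η)
    (hc : HasCompactSupport η) (hA : ∀ x, gradSq f x = A x + κ * lap (fun y => f y ^ 2) x)
    (hM : ∀ x, gradSq η x + (κ - 1 / 2) * lap (fun y => η y ^ 2) x ≤ M) (hK : MeasurableSet K)
    (hKi : IntegrableOn (fun x => f x ^ 2) K) (hηK : tsupport η ⊆ K) :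
    ∫ x, gradSq (fun y => f y * η y) x ≤ (∫ x, A x * η x ^ 2) + M * ∫ x in K, f x ^ 2 := by
  have hη1 : ContDiff ℝ 1 η := hη.of_le (by norm_num)
  have hc2 : HasCompactSupport fun y => η y ^ 2 := by
    simp only [sq]; exact hc.mul_left
  have hη2 : ContDiff ℝ 2 fun y => η y ^ 2 := hη.pow 2
  have hf2 : ContDiff ℝ 2 fun y => f y ^ 2 := hf.pow 2
  have iG : Integrable fun x => f x ^ 2 * gradSq η x :=
    (hf2.continuous.mul (ContDiff.continuous_gradSq hη1)).integrable_of_hasCompactSupport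
      (HasCompactSupport.gradSq hc).mul_left
  have iM : Integrable fun x => f x ^ 2 * lap (fun y => η y ^ 2) x :=
    (hf2.continuous.mul (ContDiff.continuous_lap hη2)).integrable_of_hasCompactSupport
      (HasCompactSupport.lap hc2).mul_left
  rw [integral_gradSq_mul hf hη hc hA, ← integral_const_mul, ← integral_indicator hK]
  refine add_le_add le_rfl ?_
  refine integral_mono ?_ ((integrable_indicator_iff hK).2 (Integrable.const_mul hKi M)) fun x => ?_
  · refine (iG.add (iM.const_mul (κ - 1 / 2))).congr (.of_forall fun x => ?_)
    simp only [Pi.add_apply]; ring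
  · by_cases hx : x ∈ K
    · simp only [indicator_of_mem hx]
      nlinarith [mul_le_mul_of_nonneg_left (hM x) (sq_nonneg (f x))]
    · have hx' : x ∉ tsupport η := fun h => hx (hηK h)
      have h1 : gradSq η x = 0 := Finset.sum_eq_zero fun i _ => by
        rw [image_eq_zero_of_notMem_tsupport fun h => hx' (tsupport_pd_subset i h)]; ring
      have h2 : lap (fun y => η y ^ 2) x = 0 := by
        refine image_eq_zero_of_notMem_tsupport fun h => hx' ?_
        have := tsupport_lap_subset h
        refine closure_mono (fun y hy => ?_) this
        simpa using hy
      simp [indicator_of_notMem hx, h1, h2]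

lemma gradSq_exp {u : En n → ℝ} (hu : ContDiff ℝ 2 u) (α : ℝ) (x : En n) :
    gradSq (fun y => Real.exp (α / 2 * u y)) x =
      α / 4 * (-lap u x * Real.exp (α * u x)) +
        1 / 4 * lap (fun y => Real.exp (α / 2 * u y) ^ 2) x := by
  have h1 : (fun y => Real.exp (α / 2 * u y) ^ 2) = fun y => Real.exp (α * u y) := by
    ext y; rw [← Real.exp_nat_mul]; congr 1; push_cast; ring
  rw [h1, lap_exp_mul hu]
  have hF (y : ℝ) : HasDerivAt (fun t => Real.exp (α / 2 * t)) (Real.exp (α / 2 * y) * (α / 2)) y := by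
    have := ((hasDerivAt_id y).const_mul (α / 2)).exp
    simpa using this
  rw [gradSq_comp (F := fun t => Real.exp (α / 2 * t)) (F' := fun y => Real.exp (α / 2 * y) * (α / 2))
    (hu.differentiable (by norm_num)) (hF _), mul_pow, ← Real.exp_nat_mul]
  rw [show ((2 : ℕ) : ℝ) * (α / 2 * u x) = α * u x by push_cast; ring]
  ring

lemma gradSq_rpow {v : En n → ℝ} (hv : ContDiff ℝ 2 v) (hpos : ∀ x, 0 < v x) {β : ℝ}
    (hβ : 2 * β - 1 ≠ 0) (x : En n) :
    gradSq (fun y => v y ^ β) x = β ^ 2 / (2 * β - 1) * (-lap v x * v x ^ (2 * β - 1)) +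
        β / (2 * (2 * β - 1)) * lap (fun y => (v y ^ β) ^ 2) x := by
  have h1 : (fun y => (v y ^ β) ^ 2) = fun y => v y ^ (2 * β) := by
    ext y; rw [← Real.rpow_mul_natCast (hpos y).le]; congr 1; push_cast; ring
  have hF (c : ℝ) (y : ℝ) (hy : y ∈ Ioi (0 : ℝ)) : HasDerivAt (fun t => t ^ c) (c * y ^ (c - 1)) y :=
    Real.hasDerivAt_rpow_const (Or.inl (ne_of_gt hy))
  rw [h1, lap_comp (F := fun t => t ^ (2 * β)) (F' := fun y => 2 * β * y ^ (2 * β - 1))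
    (F'' := fun y => 2 * β * ((2 * β - 1) * y ^ (2 * β - 1 - 1))) (s := Ioi 0) hv hpos (hF _)
    fun y hy => (hF _ y hy).const_mul _,
    gradSq_comp (F := fun t => t ^ β) (F' := fun y => β * y ^ (β - 1))
    (hv.differentiable (by norm_num)) (hF _ _ (hpos x)), mul_pow, ← Real.rpow_mul_natCast (hpos x).le]
  rw [show (β - 1) * ((2 : ℕ) : ℝ) = 2 * β - 1 - 1 by push_cast; ring]
  generalize v x ^ (2 * β - 1 - 1) = a, v x ^ (2 * β - 1) = b
  generalize hc : 2 * β - 1 = c at *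
  obtain rfl : β = (c + 1) / 2 := by linarith
  field_simp
  ring

end Energy

/-- Sobolev inequality in integral form. -/
lemma sobolev {n : ℕ} (hn : 2 < n) : ∃ C : ℝ, 0 ≤ C ∧ ∀ w : En n → ℝ, ContDiff ℝ 1 w →
    HasCompactSupport w → ∫ x, |w x| ^ (2 * n / (n - 2) : ℝ) ≤
      C * (∫ x, gradSq w x) ^ (n / (n - 2) : ℝ) := by
  have hn' : (2 : ℝ) < n := by exact_mod_cast hn
  set q : ℝ := 2 * n / (n - 2) with hq
  have hq0 : 0 < q := div_pos (by linarith) (by linarith)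
  set p' : ℝ≥0 := ⟨q, hq0.le⟩ with hp'
  set S : ℝ≥0 := eLpNormLESNormFDerivOfEqInnerConst (volume : Measure (En n)) ((2 : ℝ≥0) : ℝ)
  refine ⟨(S : ℝ) ^ q, by positivity, fun w hw hwc => ?_⟩
  have hsob := eLpNorm_le_eLpNorm_fderiv_of_eq_inner (volume : Measure (En n)) hw hwc
    (p := 2) (p' := p') (by norm_num) (by rw [finrank_euclideanSpace_fin]; omega) (by
      rw [finrank_euclideanSpace_fin]
      change q⁻¹ = _
      rw [hq]
      have : (n : ℝ) - 2 ≠ 0 := by linarith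
      have : (n : ℝ) ≠ 0 := by linarith
      push_cast
      field_simp)
  have m1 : MemLp w p' := hw.continuous.memLp_of_hasCompactSupport hwc
  have m2 : MemLp (fderiv ℝ w) (2 : ℝ≥0) :=
    (hw.continuous_fderiv one_ne_zero).memLp_of_hasCompactSupport (hwc.fderiv ℝ)
  have hp0 : (p' : ℝ≥0∞) ≠ 0 := by
    rw [ENNReal.coe_ne_zero]; intro h; exact hq0.ne' (congrArg NNReal.toReal h)
  rw [m1.eLpNorm_eq_integral_rpow_norm hp0 ENNReal.coe_ne_top,
    m2.eLpNorm_eq_integral_rpow_norm (by norm_num) ENNReal.coe_ne_top,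
    ← ENNReal.ofReal_coe_nnreal (p := S), ← ENNReal.ofReal_mul S.coe_nonneg,
    ENNReal.ofReal_le_ofReal_iff (by positivity)] at hsob
  have t1 : (p' : ℝ≥0∞).toReal = q := rfl
  have t2 : ((2 : ℝ≥0) : ℝ≥0∞).toReal = 2 := rfl
  rw [t1, t2] at hsob
  have hI : 0 ≤ ∫ x, ‖w x‖ ^ q := integral_nonneg fun x => by positivity
  have hJ : ∫ x, ‖fderiv ℝ w x‖ ^ (2 : ℝ) ≤ ∫ x, gradSq w x := by
    have h2 : Continuous fun x => ‖fderiv ℝ w x‖ ^ (2 : ℝ) :=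
      (hw.continuous_fderiv one_ne_zero).norm.rpow_const fun _ => Or.inr (by norm_num)
    refine integral_mono_of_nonneg (.of_forall fun x => by positivity)
      ((ContDiff.continuous_gradSq hw).integrable_of_hasCompactSupport
        (HasCompactSupport.gradSq hwc)) (.of_forall fun x => ?_)
    simpa using norm_fderiv_sq_le_gradSq x
  have hJ0 : 0 ≤ ∫ x, ‖fderiv ℝ w x‖ ^ (2 : ℝ) := integral_nonneg fun x => by positivity
  calc ∫ x, |w x| ^ q = ((∫ x, ‖w x‖ ^ q) ^ q⁻¹) ^ q := by
        rw [← Real.rpow_mul hI, inv_mul_cancel₀ hq0.ne', Real.rpow_one]; rfl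
    _ ≤ (S * (∫ x, ‖fderiv ℝ w x‖ ^ (2 : ℝ)) ^ (2 : ℝ)⁻¹) ^ q := by gcongr
    _ ≤ (S * (∫ x, gradSq w x) ^ (2 : ℝ)⁻¹) ^ q := by gcongr
    _ = _ := by
      have hG : 0 ≤ ∫ x, gradSq w x := integral_nonneg fun x => gradSq_nonneg _ x
      rw [Real.mul_rpow S.coe_nonneg (by positivity), ← Real.rpow_mul hG]
      congr 2
      rw [hq]; field_simp

end

section

open scoped ContDiff

section Scaling

variable {n : ℕ} {f : En n → ℝ}

lemma pd_comp_smul (r : ℝ) (i : Fin n) (x : En n) :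
    pd i (fun y => f (r • y)) x = r * pd i f (r • x) := by
  simp [pd, fderiv_comp_smul]

lemma lap_comp_smul (hf : ContDiff ℝ 2 f) (r : ℝ) (x : En n) :
    lap (fun y => f (r • y)) x = r ^ 2 * lap f (r • x) := by
  rw [lap_eq_sum, lap_eq_sum, Finset.mul_sum]
  refine Finset.sum_congr rfl fun i _ => ?_
  have h : pd i (fun y => f (r • y)) = fun y => r * pd i f (r • y) :=
    funext fun y => pd_comp_smul r i y
  have hd : Differentiable ℝ fun y => pd i f (r • y) :=
    ((ContDiff.pd (k := 1) hf (by norm_num) i).differentiable (by norm_num)).comp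
      (differentiable_id.const_smul r)
  rw [h, pd_const_mul r hd, pd_comp_smul]
  ring

end Scaling

lemma exists_radial_bump (n : ℕ) : ∃ ξ : En n → ℝ, ContDiff ℝ ∞ ξ ∧ HasCompactSupport ξ ∧
    (∀ x, 0 ≤ ξ x ∧ ξ x ≤ 1) ∧ (∀ {x : En n} {s : ℝ}, 0 < s → ‖x‖ ≤ s → ξ (s⁻¹ • x) = 1) ∧
      ∀ {x : En n} {s : ℝ}, 0 < s → 2 * s ≤ ‖x‖ → ξ (s⁻¹ • x) = 0 := by
  let ξ : ContDiffBump (0 : En n) := ⟨1, 2, one_pos, by norm_num⟩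
  refine ⟨ξ, ξ.contDiff, ξ.hasCompactSupport, fun x => ⟨ξ.nonneg, ξ.le_one⟩,
    fun {x s} hs hx => ξ.one_of_mem_closedBall ?_, fun {x s} hs hx => ξ.zero_of_le_dist ?_⟩
  · rw [mem_closedBall_zero_iff, norm_smul, norm_inv, Real.norm_of_nonneg hs.le]
    exact (inv_mul_le_one₀ hs).2 hx
  · rw [dist_zero_right, norm_smul, norm_inv, Real.norm_of_nonneg hs.le]
    change 2 ≤ _
    rw [inv_mul_eq_div, le_div_iff₀ hs]; exact hx

/-- Growth of `∫ e^u` over balls from fourth-order stability. -/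
lemma Stable4OutsideBall.integral_exp_ball_le {n : ℕ} {u : En n → ℝ} {R : ℝ} (hn : 4 < n)
    (hu : Continuous u) (hR : 0 < R) (hst : Stable4OutsideBall n u R) :
    ∃ C ρ₀ : ℝ, 0 ≤ C ∧ 0 < ρ₀ ∧ ∀ ρ, ρ₀ ≤ ρ →
      ∫ x in ball (0 : En n) ρ, Real.exp (u x) ≤ C * (ρ ^ n / ρ ^ 4) := by
  obtain ⟨ξ, ξs, ξc, -, ξ1, ξ0⟩ := exists_radial_bump n
  have ξ2 : ContDiff ℝ 2 ξ := contDiff_infty.1 ξs 2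
  set L : ℝ := ∫ x, lap ξ x ^ 2 with hL
  have L0 : 0 ≤ L := integral_nonneg fun x => sq_nonneg _
  set K : ℝ := ∫ x in ball (0 : En n) (4 * R), Real.exp (u x) with hK
  have K0 : 0 ≤ K := integral_nonneg fun x => (Real.exp_pos _).le
  have hlapint (s : ℝ) (hs : 0 < s) :
      Integrable (fun x : En n => lap ξ (s⁻¹ • x) ^ 2) ∧
      ∫ x : En n, lap ξ (s⁻¹ • x) ^ 2 = s ^ n * L := by
    constructor
    · have : Integrable (fun x : En n => lap ξ x ^ 2) := by
        refine Continuous.integrable_of_hasCompactSupport ((ContDiff.continuous_lap ξ2).pow 2) ?_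
        simp only [sq]; exact (HasCompactSupport.lap ξc).mul_left
      exact this.comp_smul (inv_ne_zero hs.ne')
    · rw [Measure.integral_comp_smul volume (fun x : En n => lap ξ x ^ 2),
        finrank_euclideanSpace_fin, inv_pow, inv_inv, abs_of_pos (by positivity), smul_eq_mul]
  refine ⟨K + 4 * L, max 1 (2 * R), by positivity, by positivity, fun ρ hρ => ?_⟩
  have hρ1 : 1 ≤ ρ := (le_max_left _ _).trans hρ
  have hρR : 2 * R ≤ ρ := (le_max_right _ _).trans hρ
  have hρ0 : 0 < ρ := by linarith
  have hR2 : 0 < 2 * R := by linarith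
  set φ : En n → ℝ := fun x => ξ (ρ⁻¹ • x) - ξ ((2 * R)⁻¹ • x) with hφ
  have hφs : ContDiff ℝ ∞ φ :=
    (ξs.comp (contDiff_id.const_smul _)).sub (ξs.comp (contDiff_id.const_smul _))
  have hφc : HasCompactSupport φ :=
    (ξc.comp_smul (inv_ne_zero hρ0.ne')).sub (ξc.comp_smul (inv_ne_zero hR2.ne'))
  have hφt : TestOn n (closedBall (0 : En n) R)ᶜ φ := by
    refine ⟨hφs, hφc, ?_⟩
    have : tsupport φ ⊆ {x | 2 * R ≤ ‖x‖} := by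
      refine closure_minimal (fun x hx => ?_) (isClosed_le continuous_const continuous_norm)
      by_contra h
      simp only [mem_ofPred_eq, not_le] at h
      exact hx (by simp only [hφ]; rw [ξ1 hρ0 (by linarith), ξ1 hR2 h.le, sub_self])
    intro x hx
    have := this hx
    simp only [mem_ofPred_eq] at this
    simp only [mem_compl_iff, mem_closedBall_zero_iff, not_le]
    linarith
  have hexp : Continuous fun x => Real.exp (u x) := Real.continuous_exp.comp hu
  have iφ : Integrable fun x => Real.exp (u x) * φ x ^ 2 := by
    refine (hexp.mul (hφs.continuous.pow 2)).integrable_of_hasCompactSupport ?_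
    simp only [sq]; exact (hφc.mul_left).mul_left
  have iball (s : ℝ) : IntegrableOn (fun x => Real.exp (u x)) (ball (0 : En n) s) :=
    (hexp.continuousOn.integrableOn_compact (isCompact_closedBall _ s)).mono_set ball_subset_closedBall
  have h1 : ∫ x in ball (0 : En n) ρ, Real.exp (u x) ≤ K + ∫ x, Real.exp (u x) * φ x ^ 2 := by
    rw [hK, ← integral_indicator measurableSet_ball, ← integral_indicator measurableSet_ball,
      ← integral_add ((iball _).integrable_indicator measurableSet_ball) iφ]
    refine integral_mono ((iball _).integrable_indicator measurableSet_ball)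
      (((iball _).integrable_indicator measurableSet_ball).add iφ) fun x => ?_
    have e0 := (Real.exp_pos (u x)).le
    have e1 : 0 ≤ Real.exp (u x) * φ x ^ 2 := by positivity
    have e2 : 0 ≤ (ball (0 : En n) (4 * R)).indicator (fun x => Real.exp (u x)) x :=
      indicator_nonneg (fun x _ => (Real.exp_pos _).le) x
    by_cases ha : x ∈ ball (0 : En n) ρ
    · rw [indicator_of_mem ha]
      by_cases hb : x ∈ ball (0 : En n) (4 * R)
      · rw [indicator_of_mem hb]; linarith
      · have : φ x = 1 := by
          simp only [mem_ball_zero_iff, not_lt] at ha hb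
          simp only [hφ]; rw [ξ1 hρ0 ha.le, ξ0 hR2 (by linarith), sub_zero]
        rw [this]; linarith
    · rw [indicator_of_notMem ha]; linarith
  have hcomp (s : ℝ) : ContDiff ℝ 2 fun x : En n => ξ (s⁻¹ • x) :=
    ξ2.comp (contDiff_id.const_smul s⁻¹)
  have h2 : ∫ x, lap φ x ^ 2 ≤ 2 * L * (ρ ^ n / ρ ^ 4) + 2 * L * ((2 * R) ^ n / (2 * R) ^ 4) := by
    have e (x : En n) : lap φ x = (ρ⁻¹) ^ 2 * lap ξ (ρ⁻¹ • x) -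
        ((2 * R)⁻¹) ^ 2 * lap ξ ((2 * R)⁻¹ • x) := by
      rw [hφ, lap_sub (hcomp ρ) (hcomp (2 * R)), lap_comp_smul ξ2, lap_comp_smul ξ2]
    obtain ⟨i1, j1⟩ := hlapint ρ hρ0
    obtain ⟨i2, j2⟩ := hlapint (2 * R) hR2
    calc ∫ x, lap φ x ^ 2 ≤ ∫ x, (2 * (ρ⁻¹) ^ 4 * lap ξ (ρ⁻¹ • x) ^ 2 +
          2 * ((2 * R)⁻¹) ^ 4 * lap ξ ((2 * R)⁻¹ • x) ^ 2) := by
          refine integral_mono_of_nonneg (.of_forall fun x => sq_nonneg _)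
            ((i1.const_mul _).add (i2.const_mul _)) (.of_forall fun x => ?_)
          simp only [e]
          nlinarith [sq_nonneg ((ρ⁻¹) ^ 2 * lap ξ (ρ⁻¹ • x) +
            ((2 * R)⁻¹) ^ 2 * lap ξ ((2 * R)⁻¹ • x))]
      _ = _ := by
          rw [integral_add (i1.const_mul _) (i2.const_mul _), integral_const_mul,
            integral_const_mul, j1, j2]
          simp only [inv_pow, div_eq_mul_inv]; ring
  have mono {s t : ℝ} (hs : 0 < s) (hst : s ≤ t) : s ^ n / s ^ 4 ≤ t ^ n / t ^ 4 := by
    have ht : 0 < t := hs.trans_le hst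
    rw [div_eq_mul_inv, div_eq_mul_inv, ← pow_sub₀ _ hs.ne' hn.le, ← pow_sub₀ _ ht.ne' hn.le]
    exact pow_le_pow_left₀ hs.le hst _
  have h3 := hst φ hφt
  have h4 := mono hR2 hρR
  have h5 := mono one_pos hρ1
  simp only [one_pow, div_one] at h5
  nlinarith [mul_le_mul_of_nonneg_left h4 L0, mul_le_mul_of_nonneg_left h5 K0]

/-- Decay of the local averages of a positive superharmonic function vanishing at infinity. -/
lemma integral_comp_smul_le_of_lap_eq_neg {n : ℕ} {v g : En n → ℝ} (hn : 4 < n)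
    (hv : ContDiff ℝ 2 v) (hg : Continuous g) (h0 : ∀ x, 0 ≤ v x) (g0 : ∀ x, 0 ≤ g x)
    (hlap : ∀ x, lap v x = -g x) (hvan : Tendsto v (cocompact (En n)) (nhds 0))
    (hgrow : ∃ C ρ₀ : ℝ, 0 ≤ C ∧ 0 < ρ₀ ∧ ∀ ρ, ρ₀ ≤ ρ →
      ∫ x in ball (0 : En n) ρ, g x ≤ C * (ρ ^ n / ρ ^ 4)) {b : ℝ} (hb : 0 < b) :
    ∃ C r₀ : ℝ, 0 < r₀ ∧ ∀ r, r₀ ≤ r → ∫ x in ball (0 : En n) b, r ^ 2 * v (r • x) ≤ C := by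
  obtain ⟨C, ρ₀, C0, hρ₀, hC⟩ := hgrow
  set c : ℝ := b ^ 2 + 1 with hc
  have c1 : 1 ≤ c := by rw [hc]; nlinarith
  have c0 : 0 < c := by linarith
  set G : ℝ → ℝ := fun t => t⁻¹ ^ 2 * expNegInvGlue t with hG
  have hF (t : ℝ) : HasDerivAt expNegInvGlue (G t) t := by
    simpa [hG] using expNegInvGlue.hasDerivAt_polynomial_eval_inv_mul 1 t
  have hGc : Continuous G := by
    have : G = deriv expNegInvGlue := funext fun t => (hF t).deriv.symm
    rw [this]
    exact (expNegInvGlue.contDiff (n := 1)).continuous_deriv le_rfl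
  have G0 (t : ℝ) : 0 ≤ G t := mul_nonneg (sq_nonneg _) (expNegInvGlue.nonneg t)
  set θ : En n → ℝ := fun y => expNegInvGlue (c - ‖y - 0‖ ^ 2) with hθ
  set Φ : En n → ℝ := fun y => 2 * G (c - ‖y - 0‖ ^ 2) with hΦ
  have hq : ContDiff ℝ 2 fun y : En n => c - ‖y - 0‖ ^ 2 :=
    contDiff_const.sub (contDiff_norm_sub_sq 0)
  have hθ2 : ContDiff ℝ 2 θ := expNegInvGlue.contDiff.comp hq
  have hΦc : Continuous Φ := continuous_const.mul (hGc.comp hq.continuous)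
  have Φ0 (y : En n) : 0 ≤ Φ y := mul_nonneg (by norm_num) (G0 _)
  have hout {y : En n} (hy : y ∉ closedBall (0 : En n) c) : c - ‖y - 0‖ ^ 2 ≤ 0 := by
    simp only [mem_closedBall_zero_iff, not_le, sub_zero] at hy ⊢
    nlinarith
  have θout {y : En n} (hy : y ∉ closedBall (0 : En n) c) : θ y = 0 :=
    expNegInvGlue.zero_of_nonpos (hout hy)
  have Φout {y : En n} (hy : y ∉ closedBall (0 : En n) c) : Φ y = 0 := by
    simp only [hΦ, hG, expNegInvGlue.zero_of_nonpos (hout hy), mul_zero]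
  have θc : HasCompactSupport θ := .intro (isCompact_closedBall 0 c) fun y hy => θout hy
  have Φcs : HasCompactSupport Φ := .intro (isCompact_closedBall 0 c) fun y hy => Φout hy
  have pdθ (i : Fin n) (y : En n) : pd i θ y = -(y i * Φ y) := by
    rw [hθ, pd_comp (F := expNegInvGlue) (F' := G) (hq.differentiable (by norm_num)) (hF _),
      pd_sub (differentiable_const c) ((contDiff_norm_sub_sq (k := 1) 0).differentiable (by norm_num)),
      pd_norm_sub_sq]
    simp [hΦ, pd]
    ring
  set N : ℝ → ℝ := fun r => ∫ y, v (r • y) * Φ y with hN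
  have hv1 : ContDiff ℝ 1 v := hv.of_le (by norm_num)
  have hvs (r : ℝ) : Continuous fun y : En n => v (r • y) :=
    hv.continuous.comp (continuous_const_smul r)
  have hgs (r : ℝ) : Continuous fun y : En n => g (r • y) := hg.comp (continuous_const_smul r)
  have hFc : Continuous fun p : ℝ × En n => fderiv ℝ v (p.1 • p.2) p.2 * Φ p.2 :=
    ((((hv1.continuous_fderiv one_ne_zero).comp (continuous_fst.smul continuous_snd))).clm_apply
      continuous_snd).mul (hΦc.comp continuous_snd)
  have hNd (r : ℝ) : HasDerivAt N (∫ y, fderiv ℝ v (r • y) y * Φ y) r := by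
    obtain ⟨M, hM⟩ := ((isCompact_closedBall r 1).prod
      (isCompact_closedBall (0 : En n) c)).exists_bound_of_continuousOn hFc.continuousOn
    refine (hasDerivAt_integral_of_dominated_loc_of_deriv_le (s := closedBall r 1)
      (bound := (closedBall (0 : En n) c).indicator fun _ => M)
      (F := fun r y => v (r • y) * Φ y) (F' := fun r y => fderiv ℝ v (r • y) y * Φ y)
      (closedBall_mem_nhds r one_pos)
      (.of_forall fun s => ((hvs s).mul hΦc).aestronglyMeasurable)
      (((hvs r).mul hΦc).integrable_of_hasCompactSupport Φcs.mul_left)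
      (hFc.comp (Continuous.prodMk_right r)).aestronglyMeasurable
      (.of_forall fun y s hs => ?_) ?_ (.of_forall fun y s _ => ?_)).2
    · by_cases hy : y ∈ closedBall (0 : En n) c
      · rw [indicator_of_mem hy]; exact hM (s, y) ⟨hs, hy⟩
      · rw [indicator_of_notMem hy, Φout hy]; simp
    · exact (integrable_indicator_iff measurableSet_closedBall).2
        (integrableOn_const (isCompact_closedBall (0 : En n) c).measure_lt_top.ne)
    · refine HasDerivAt.mul_const ?_ _
      have h1 : HasDerivAt (fun s : ℝ => s • y) y s := by
        simpa using (hasDerivAt_id s).smul_const y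
      exact ((hv1.differentiable one_ne_zero _).hasFDerivAt).comp_hasDerivAt s h1
  have hNd' (r : ℝ) (hr : 0 < r) : ∫ y, fderiv ℝ v (r • y) y * Φ y =
      -(r * ∫ y, g (r • y) * θ y) := by
    have hw : ContDiff ℝ 2 fun y : En n => v (r • y) := hv.comp (contDiff_id.const_smul r)
    have e1 := integral_mul_lap (hw.of_le (by norm_num)) hθ2 θc
    rw [← integral_lap_mul hw hθ2 θc] at e1
    have e2 (y : En n) : ∑ i, pd i (fun y => v (r • y)) y * pd i θ y =
        -(r * (fderiv ℝ v (r • y) y * Φ y)) := by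
      have : fderiv ℝ v (r • y) y = ∑ i, y i * pd i v (r • y) := by
        have h := congrArg (fderiv ℝ v (r • y)) ((EuclideanSpace.basisFun (Fin n) ℝ).sum_repr y)
        rw [← h, map_sum]
        simp [pd]
      rw [this, Finset.sum_mul, Finset.mul_sum, ← Finset.sum_neg_distrib]
      refine Finset.sum_congr rfl fun i _ => ?_
      rw [pd_comp_smul, pdθ]; ring
    have e3 (y : En n) : lap (fun y => v (r • y)) y * θ y = -(r ^ 2 * (g (r • y) * θ y)) := by
      rw [lap_comp_smul hv, hlap]; ring
    simp only [e2, e3, integral_neg, integral_const_mul, neg_neg] at e1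
    have := mul_left_cancel₀ hr.ne' (b := ∫ y, fderiv ℝ v (r • y) y * Φ y)
      (c := -(r * ∫ y, g (r • y) * θ y)) (by linarith)
    exact this
  set C₁ : ℝ := C * ((2 * c) ^ n / (2 * c) ^ 4) with hC₁
  have hC₁0 : 0 ≤ C₁ := by positivity
  have hgθ (r : ℝ) (hr : ρ₀ ≤ r) : ∫ y, g (r • y) * θ y ≤ C₁ / r ^ 4 := by
    have hr0 : 0 < r := hρ₀.trans_le hr
    have h1 : ∫ y, g (r • y) * θ y ≤ ∫ y in ball (0 : En n) (2 * c), g (r • y) := by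
      rw [← integral_indicator measurableSet_ball]
      refine integral_mono (((hgs r).mul hθ2.continuous).integrable_of_hasCompactSupport θc.mul_left)
        ((integrable_indicator_iff measurableSet_ball).2 (((hgs r).continuousOn.integrableOn_compact
          (isCompact_closedBall _ _)).mono_set ball_subset_closedBall)) fun y => ?_
      by_cases hy : y ∈ closedBall (0 : En n) c
      · rw [indicator_of_mem (closedBall_subset_ball (by linarith) hy)]
        have : θ y ≤ 1 := by
          simp only [hθ, expNegInvGlue]
          split_ifs
          · norm_num
          · exact Real.exp_le_one_iff.2 (by rw [neg_nonpos, inv_nonneg]; linarith)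
        exact mul_le_of_le_one_right (g0 _) this
      · simp only [θout hy, mul_zero]
        exact indicator_nonneg (fun y _ => g0 _) _
    rw [Measure.setIntegral_comp_smul_of_pos _ _ _ hr0, _root_.smul_ball hr0.ne', smul_zero,
      Real.norm_of_nonneg hr0.le, finrank_euclideanSpace_fin, smul_eq_mul] at h1
    have h2 := hC (r * (2 * c)) (by nlinarith)
    refine h1.trans ((mul_le_mul_of_nonneg_left h2 (by positivity)).trans_eq ?_)
    rw [hC₁, mul_pow, mul_pow]; field_simp
  have hmono : MonotoneOn (fun r => N r - C₁ / 2 * (r ^ 2)⁻¹) (Ici ρ₀) := by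
    have hd (r : ℝ) (hr : 0 < r) : HasDerivAt (fun r => N r - C₁ / 2 * (r ^ 2)⁻¹)
        (-(r * ∫ y, g (r • y) * θ y) - C₁ / 2 * (-(2 * r) / (r ^ 2) ^ 2)) r := by
      have h := hNd r
      rw [hNd' r hr] at h
      refine h.sub (HasDerivAt.const_mul _ ?_)
      have := (hasDerivAt_pow 2 r).inv (by positivity)
      simp only [Nat.cast_ofNat, Nat.add_one_sub_one, pow_one] at this
      exact this
    refine monotoneOn_of_deriv_nonneg (convex_Ici ρ₀) (fun r hr =>
      (hd r (hρ₀.trans_le hr)).continuousAt.continuousWithinAt) (fun r hr => ?_) fun r hr => ?_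
    · rw [interior_Ici] at hr
      exact (hd r (hρ₀.trans hr)).differentiableAt.differentiableWithinAt
    · rw [interior_Ici] at hr
      have hr0 : 0 < r := hρ₀.trans hr
      rw [(hd r hr0).deriv]
      have := mul_le_mul_of_nonneg_left (hgθ r (le_of_lt hr)) hr0.le
      have e : C₁ / 2 * (-(2 * r) / (r ^ 2) ^ 2) = -(r * (C₁ / r ^ 4)) := by field_simp
      rw [e]; linarith
  have hNlim : Tendsto N atTop (nhds 0) := by
    obtain ⟨M, hM⟩ : ∃ M, ∀ x, ‖v x‖ ≤ M := by
      have h1 : ∀ᶠ x in cocompact (En n), ‖v x‖ < 1 := by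
        simpa using hvan.norm.eventually (gt_mem_nhds (show ‖(0 : ℝ)‖ < 1 by simp))
      obtain ⟨K, hK, hK1⟩ := mem_cocompact.1 h1
      obtain ⟨M, hM⟩ := hK.exists_bound_of_continuousOn hv.continuous.continuousOn
      refine ⟨max M 1, fun x => ?_⟩
      by_cases hx : x ∈ K
      · exact (hM x hx).trans (le_max_left _ _)
      · exact (le_of_lt (hK1 hx)).trans (le_max_right _ _)
    have : Nonempty (Fin n) := ⟨⟨0, by omega⟩⟩
    have h := tendsto_integral_filter_of_dominated_convergence (μ := volume) (l := atTop (α := ℝ))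
      (F := fun (r : ℝ) (y : En n) => v (r • y) * Φ y) (f := fun _ => 0) (fun y => M * Φ y)
      (.of_forall fun s => ((hvs s).mul hΦc).aestronglyMeasurable)
      (.of_forall fun s => .of_forall fun y => by
        rw [norm_mul, Real.norm_of_nonneg (Φ0 y)]
        exact mul_le_mul_of_nonneg_right (hM _) (Φ0 y))
      ((hΦc.integrable_of_hasCompactSupport Φcs).const_mul M) ?_
    · simpa using h
    · have hae : ∀ᵐ y : En n, y ≠ 0 := by
        simp [ae_iff]
      filter_upwards [hae] with y hy
      have h1 : Tendsto (fun r : ℝ => r • y) atTop (cocompact (En n)) := by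
        rw [← Metric.cobounded_eq_cocompact, ← tendsto_norm_atTop_iff_cobounded]
        simp only [norm_smul]
        exact tendsto_norm_atTop_atTop.atTop_mul_const (norm_pos_iff.2 hy)
      simpa using (hvan.comp h1).mul_const (Φ y)
  have hNle (r : ℝ) (hr : ρ₀ ≤ r) : N r ≤ C₁ / 2 * (r ^ 2)⁻¹ := by
    have hlim : Tendsto (fun r => N r - C₁ / 2 * (r ^ 2)⁻¹) atTop (nhds (0 - C₁ / 2 * 0)) :=
      hNlim.sub ((tendsto_inv_atTop_zero.comp (tendsto_pow_atTop two_ne_zero)).const_mul _)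
    rw [mul_zero, sub_zero] at hlim
    have := ge_of_tendsto hlim (b := N r - C₁ / 2 * (r ^ 2)⁻¹) (by
      filter_upwards [eventually_ge_atTop r] with s hs
      exact hmono hr (hr.trans hs) hs)
    linarith
  set m : ℝ := 2 * (c⁻¹ ^ 2 * expNegInvGlue 1) with hm
  have m0 : 0 < m := by
    have := expNegInvGlue.pos_of_pos one_pos
    positivity
  have hmΦ {y : En n} (hy : y ∈ ball (0 : En n) b) : m ≤ Φ y := by
    simp only [mem_ball_zero_iff] at hy
    have hy2 : ‖y‖ ^ 2 ≤ b ^ 2 := by gcongr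
    have h1 : 1 ≤ c - ‖y - 0‖ ^ 2 := by rw [sub_zero, hc]; linarith
    have h2 : c - ‖y - 0‖ ^ 2 ≤ c := by nlinarith [sq_nonneg ‖y - 0‖]
    simp only [hm, hΦ, hG]
    gcongr
    · exact expNegInvGlue.nonneg 1
    · exact expNegInvGlue.monotone h1
  refine ⟨C₁ / 2 / m, ρ₀, hρ₀, fun r hr => ?_⟩
  have hr0 : 0 < r := hρ₀.trans_le hr
  rw [integral_const_mul, le_div_iff₀ m0]
  have h1 : (∫ x in ball (0 : En n) b, v (r • x)) * m ≤ N r := by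
    rw [← integral_mul_const, ← integral_indicator measurableSet_ball]
    refine integral_mono_of_nonneg (.of_forall fun y => indicator_nonneg
      (fun y _ => mul_nonneg (h0 _) m0.le) y)
      (((hvs r).mul hΦc).integrable_of_hasCompactSupport Φcs.mul_left) (.of_forall fun y => ?_)
    by_cases hy : y ∈ ball (0 : En n) b
    · simp only [indicator_of_mem hy]
      exact mul_le_mul_of_nonneg_left (hmΦ hy) (h0 _)
    · simp only [indicator_of_notMem hy]
      exact mul_nonneg (h0 _) (Φ0 _)
  calc r ^ 2 * (∫ x in ball (0 : En n) b, v (r • x)) * m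
      = r ^ 2 * ((∫ x in ball (0 : En n) b, v (r • x)) * m) := by ring
    _ ≤ r ^ 2 * (C₁ / 2 * (r ^ 2)⁻¹) := by
        exact mul_le_mul_of_nonneg_left (h1.trans (hNle r hr)) (sq_nonneg r)
    _ = C₁ / 2 := by field_simp

end

section

open scoped ContDiff

/-- The closed annulus `{a ≤ ‖x‖ ≤ b}`. -/
def annulus (n : ℕ) (a b : ℝ) : Set (En n) := closedBall 0 b \ ball 0 a

lemma mem_annulus {n : ℕ} {a b : ℝ} {x : En n} : x ∈ annulus n a b ↔ a ≤ ‖x‖ ∧ ‖x‖ ≤ b := by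
  simp [annulus, and_comm]

lemma isCompact_annulus (n : ℕ) (a b : ℝ) : IsCompact (annulus n a b) :=
  (isCompact_closedBall 0 b).diff isOpen_ball

lemma measurableSet_annulus (n : ℕ) (a b : ℝ) : MeasurableSet (annulus n a b) :=
  (isCompact_annulus n a b).measurableSet

lemma exists_annulus_cutoff (n : ℕ) {a b : ℝ} (ha : 0 < a) (hab : a ≤ b) : ∃ η : En n → ℝ,
    ContDiff ℝ ∞ η ∧ HasCompactSupport η ∧ (∀ x, 0 ≤ η x ∧ η x ≤ 1) ∧
      (∀ x ∈ annulus n a b, η x = 1) ∧ tsupport η ⊆ annulus n (a / 2) (2 * b) := by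
  have hb : 0 < b := ha.trans_le hab
  have ha2 : 0 < a / 2 := by linarith
  obtain ⟨ξ, ξs, ξc, ξ01, ξ1, ξ0⟩ := exists_radial_bump n
  have hsupp : tsupport (fun x : En n => ξ (b⁻¹ • x) - ξ ((a / 2)⁻¹ • x)) ⊆
      annulus n (a / 2) (2 * b) := by
    refine closure_minimal (fun x hx => ?_) (isCompact_annulus n _ _).isClosed
    by_contra h
    rw [mem_annulus, not_and_or, not_le, not_le] at h
    refine hx ?_
    rcases h with h | h
    · simp only; rw [ξ1 hb (by linarith), ξ1 ha2 h.le, sub_self]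
    · simp only; rw [ξ0 hb h.le, ξ0 ha2 (by linarith), sub_self]
  refine ⟨fun x => ξ (b⁻¹ • x) - ξ ((a / 2)⁻¹ • x),
    (ξs.comp (contDiff_id.const_smul _)).sub (ξs.comp (contDiff_id.const_smul _)),
    (isCompact_annulus n _ _).of_isClosed_subset (isClosed_tsupport _) hsupp,
    fun x => ?_, fun x hx => ?_, hsupp⟩
  · rcases le_total ‖x‖ b with h | h
    · simp only; rw [ξ1 hb h]
      exact ⟨sub_nonneg.2 (ξ01 _).2, sub_le_self _ (ξ01 _).1⟩
    · simp only; rw [ξ0 ha2 (by linarith), sub_zero]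
      exact ξ01 _
  · rw [mem_annulus] at hx
    simp only
    rw [ξ1 hb hx.2, ξ0 ha2 (by linarith [hx.1]), sub_zero]

/-- `u` and `v = -Δu` solve the system `-Δu = v`, `-Δv = e^u`, with `v ≥ e^{u/2}`. -/
structure IsSystemSol {n : ℕ} (u v : En n → ℝ) : Prop where
  contDiff_left : ContDiff ℝ 2 u
  contDiff_right : ContDiff ℝ 2 v
  lap_left : ∀ x, lap u x = -v x
  lap_right : ∀ x, lap v x = -Real.exp (u x)
  exp_half_le : ∀ x, Real.exp (1 / 2 * u x) ≤ v x

namespace IsSystemSol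

variable {n : ℕ} {u v : En n → ℝ}

lemma pos (h : IsSystemSol u v) (x : En n) : 0 < v x := (Real.exp_pos _).trans_le (h.exp_half_le x)

lemma contDiff_rpow (h : IsSystemSol u v) (β : ℝ) : ContDiff ℝ 2 fun x => v x ^ β :=
  h.contDiff_right.rpow_const_of_ne fun x => (h.pos x).ne'

lemma continuous_rpow (h : IsSystemSol u v) (β : ℝ) : Continuous fun x => v x ^ β :=
  (h.contDiff_rpow β).continuous

lemma exp_le_rpow (h : IsSystemSol u v) {p : ℝ} (hp : 0 ≤ p) (x : En n) :
    Real.exp (p * u x) ≤ v x ^ (2 * p) := by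
  have : Real.exp (p * u x) = Real.exp (1 / 2 * u x) ^ (2 * p) := by
    rw [← Real.exp_mul]; congr 1; ring
  rw [this]
  exact Real.rpow_le_rpow (Real.exp_pos _).le (h.exp_half_le x) (by linarith)

end IsSystemSol

lemma exists_cutoff_bound {n : ℕ} {η : En n → ℝ} (hη : ContDiff ℝ 2 η) (hc : HasCompactSupport η)
    (κ : ℝ) : ∃ M, 0 ≤ M ∧ ∀ x, gradSq η x + κ * lap (fun y => η y ^ 2) x ≤ M := by
  have hc2 : HasCompactSupport fun y => η y ^ 2 := by
    simp only [sq]; exact hc.mul_left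
  have hη1 : ContDiff ℝ 1 η := hη.of_le (by norm_num)
  have c1 : Continuous fun x => gradSq η x + κ * lap (fun y => η y ^ 2) x :=
    (ContDiff.continuous_gradSq hη1).add ((ContDiff.continuous_lap (hη.pow 2)).const_mul κ)
  have c2 : HasCompactSupport fun x => gradSq η x + κ * lap (fun y => η y ^ 2) x :=
    (HasCompactSupport.gradSq hc).add (HasCompactSupport.lap hc2).mul_left
  obtain ⟨M, hM⟩ := c1.bounded_above_of_compact_support c2
  exact ⟨M, (norm_nonneg _).trans (hM 0), fun x => (Real.le_norm_self _).trans (hM x)⟩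

lemma integral_mul_sq_le {n : ℕ} {g η : En n → ℝ} {K : Set (En n)} (hg : Continuous g)
    (g0 : ∀ x, 0 ≤ g x) (h01 : ∀ x, 0 ≤ η x ∧ η x ≤ 1) (hK : IsCompact K) (hηK : tsupport η ⊆ K) :
    ∫ x, g x * η x ^ 2 ≤ ∫ x in K, g x := by
  rw [← integral_indicator hK.measurableSet]
  refine integral_mono_of_nonneg (.of_forall fun x => mul_nonneg (g0 x) (sq_nonneg _))
    ((integrable_indicator_iff hK.measurableSet).2 (hg.continuousOn.integrableOn_compact hK))
    (.of_forall fun x => ?_)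
  by_cases hx : x ∈ K
  · simp only [indicator_of_mem hx]
    have := h01 x
    exact mul_le_of_le_one_right (g0 x) (pow_le_one₀ this.1 this.2)
  · simp only [indicator_of_notMem hx, image_eq_zero_of_notMem_tsupport fun h => hx (hηK h)]
    simp

/-- Energy bound for subcritical powers of `v`, for which the right side has a good sign. -/
lemma IsSystemSol.integral_gradSq_rpow_le_of_lt_half {n : ℕ} {η : En n → ℝ} {K : Set (En n)}
    (hη : ContDiff ℝ 2 η) (hc : HasCompactSupport η) (hK : IsCompact K) (hηK : tsupport η ⊆ K)
    {β : ℝ} (hβ : β < 1 / 2) : ∃ C, 0 ≤ C ∧ ∀ u v : En n → ℝ, IsSystemSol u v →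
      ∫ x, gradSq (fun y => v y ^ β * η y) x ≤ C * ∫ x in K, v x ^ (2 * β) := by
  obtain ⟨M, M0, hM⟩ := exists_cutoff_bound hη hc (β / (2 * (2 * β - 1)) - 1 / 2)
  refine ⟨M, M0, fun u v h => ?_⟩
  have e (x : En n) : (v x ^ β) ^ 2 = v x ^ (2 * β) := by
    rw [← Real.rpow_mul_natCast (h.pos x).le]; congr 1; push_cast; ring
  have h1 := integral_gradSq_mul_le (h.contDiff_rpow β) hη hc
    (gradSq_rpow h.contDiff_right h.pos (by linarith)) hM hK.measurableSet
    (((h.continuous_rpow β).pow 2).continuousOn.integrableOn_compact hK) hηK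
  simp only [e] at h1
  refine h1.trans (add_le_of_nonpos_left (integral_nonpos fun x => ?_))
  rw [h.lap_right, neg_neg]
  refine mul_nonpos_of_nonpos_of_nonneg (mul_nonpos_of_nonpos_of_nonneg
    (div_nonpos_of_nonneg_of_nonpos (sq_nonneg _) (by linarith)) ?_) (sq_nonneg _)
  exact mul_nonneg (Real.exp_pos _).le (Real.rpow_nonneg (h.pos x).le _)

lemma rpow_mul_add_le {m s t : ℝ} (hm : 1 ≤ m) (hs : 0 < s) (ht : 0 < t) :
    s ^ (m - 1) * t + s * t ^ (m - 1) ≤ s ^ m + t ^ m := by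
  have e (x : ℝ) (hx : 0 < x) : x ^ m = x ^ (m - 1) * x := by
    rw [Real.rpow_sub_one hx.ne', div_mul_cancel₀ _ hx.ne']
  rw [e s hs, e t ht]
  have hm' : 0 ≤ m - 1 := by linarith
  rcases le_total s t with h | h
  · nlinarith [mul_nonneg (sub_nonneg.2 (Real.rpow_le_rpow hs.le h hm')) (sub_nonneg.2 h)]
  · nlinarith [mul_nonneg (sub_nonneg.2 (Real.rpow_le_rpow ht.le h hm')) (sub_nonneg.2 h)]

/-- Absorption of the two cross terms in the coupled energy inequalities. -/
lemma exists_absorption {m a b : ℝ} (hm : 1 < m) (ha : 0 < a) (hb : 0 < b) (hab : a * b < 1) :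
    ∃ l θ : ℝ, 0 < l ∧ 0 ≤ θ ∧ θ < 1 ∧ ∀ e t : ℝ, 0 < e → 0 < t →
      l * (a * (t * e ^ m)) + b * (e ^ 2 * t ^ (m - 1)) ≤
        θ * (l * (e * e ^ m) + e * t ^ m) := by
  obtain ⟨s, hs1, hs2⟩ := exists_between (show b < 1 / a by rwa [lt_div_iff₀ ha, mul_comm])
  have hs : 0 < s := hb.trans hs1
  rw [lt_div_iff₀ ha] at hs2
  refine ⟨s ^ m, max (a * s) (b / s), by positivity, by positivity,
    max_lt (by linarith) ((div_lt_one hs).2 hs1), fun e t he ht => ?_⟩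
  have h := rpow_mul_add_le hm.le (mul_pos hs he) ht
  rw [Real.mul_rpow hs.le he.le, Real.mul_rpow hs.le he.le] at h
  have eq1 (x : ℝ) (hx : 0 < x) : x ^ m = x ^ (m - 1) * x := by
    rw [Real.rpow_sub_one hx.ne', div_mul_cancel₀ _ hx.ne']
  have h1 : s ^ m * (a * (t * e ^ m)) = a * s * (e * (s ^ (m - 1) * e ^ (m - 1) * t)) := by
    rw [eq1 s hs, eq1 e he]; ring
  have h2 : b * (e ^ 2 * t ^ (m - 1)) = b / s * (e * (s * e * t ^ (m - 1))) := by
    field_simp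
  rw [h1, h2]
  calc a * s * (e * (s ^ (m - 1) * e ^ (m - 1) * t)) + b / s * (e * (s * e * t ^ (m - 1)))
      ≤ max (a * s) (b / s) * (e * (s ^ (m - 1) * e ^ (m - 1) * t)) +
        max (a * s) (b / s) * (e * (s * e * t ^ (m - 1))) := by
        gcongr
        · exact le_max_left _ _
        · exact le_max_right _ _
    _ = max (a * s) (b / s) * (e * (s ^ (m - 1) * e ^ (m - 1) * t + s * e * t ^ (m - 1))) := by ring
    _ ≤ max (a * s) (b / s) * (e * (s ^ m * e ^ m + t ^ m)) := by gcongr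
    _ = _ := by ring

end

section

open scoped ContDiff

set_option maxHeartbeats 1000000 in
/-- Coupled energy estimates in the range of exponents allowed by stability. -/
lemma IsSystemSol.stable_energy_le {n : ℕ} {η χ : En n → ℝ} {K : Set (En n)}
    (hη : ContDiff ℝ ∞ η) (hc : HasCompactSupport η) (h01 : ∀ x, 0 ≤ η x ∧ η x ≤ 1)
    (hK : IsCompact K) (hηK : tsupport η ⊆ K) (hχ : ContDiff ℝ ∞ χ) (hχc : HasCompactSupport χ)
    (hχ01 : ∀ x, 0 ≤ χ x ∧ χ x ≤ 1) (hχη : ∀ x ∈ K, χ x = 1) {α : ℝ} (hα : 1 / 2 < α)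
    (hα3 : α ^ 3 - 8 * α + 4 < 0) :
    ∃ C, 0 ≤ C ∧ ∀ (u v : En n → ℝ) (R : ℝ), IsSystemSol u v → Stable4OutsideBall n u R →
      tsupport χ ⊆ (closedBall 0 R)ᶜ →
      ∫ x, gradSq (fun y => v y ^ α * η y) x ≤ C * ∫ x in K, v x ^ (2 * α) ∧
      ∫ x, Real.exp ((α + 1 / 2) * u x) * η x ^ 2 ≤ C * ∫ x in K, v x ^ (2 * α) := by
  have hη2 : ContDiff ℝ 2 η := contDiff_infty.1 hη 2
  have hη1 : ContDiff ℝ 1 η := hη2.of_le (by norm_num)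
  have hm : 0 < 2 * α - 1 := by linarith
  obtain ⟨ε, hε, hab⟩ : ∃ ε : ℝ, 0 < ε ∧
      ((1 + ε) * (α / 4)) * ((1 + ε) * (α ^ 2 / (2 * α - 1))) < 1 := by
    have hcont : Continuous fun ε : ℝ =>
        ((1 + ε) * (α / 4)) * ((1 + ε) * (α ^ 2 / (2 * α - 1))) := by fun_prop
    have h0 : ((1 + (0 : ℝ)) * (α / 4)) * ((1 + 0) * (α ^ 2 / (2 * α - 1))) < 1 := by
      have : ((1 + (0 : ℝ)) * (α / 4)) * ((1 + 0) * (α ^ 2 / (2 * α - 1))) =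
          α ^ 3 / (4 * (2 * α - 1)) := by field_simp; ring
      rw [this, div_lt_one (by linarith)]; linarith
    have h1 : ∀ᶠ ε in nhdsWithin (0 : ℝ) (Ioi 0),
        ((1 + ε) * (α / 4)) * ((1 + ε) * (α ^ 2 / (2 * α - 1))) < 1 :=
      (hcont.continuousAt.eventually (gt_mem_nhds h0)).filter_mono nhdsWithin_le_nhds
    obtain ⟨ε, h2, h3⟩ := (h1.and self_mem_nhdsWithin).exists
    exact ⟨ε, h3, h2⟩
  set a : ℝ := (1 + ε) * (α / 4) with ha
  set b : ℝ := (1 + ε) * (α ^ 2 / (2 * α - 1)) with hb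
  have a0 : 0 < a := by positivity
  have b0 : 0 < b := by positivity
  obtain ⟨l, θ, l0, θ0, θ1, habs⟩ := exists_absorption (m := 2 * α) (by linarith) a0 b0 hab
  obtain ⟨Cs, Cs0, hS⟩ := stable_second_order hε hχ hχc hχ01
  obtain ⟨M₁, hM₁0, hM₁⟩ := exists_cutoff_bound hη2 hc (1 / 4 - 1 / 2)
  obtain ⟨M₂, hM₂0, hM₂⟩ := exists_cutoff_bound hη2 hc (α / (2 * (2 * α - 1)) - 1 / 2)
  set B₁ : ℝ := (1 + ε) * M₁ + Cs with hB₁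
  set B₂ : ℝ := (1 + ε) * M₂ + Cs with hB₂
  have hB₁0 : 0 ≤ B₁ := by positivity
  have hB₂0 : 0 ≤ B₂ := by positivity
  set B : ℝ := (l * B₁ + B₂) / (1 - θ) with hB
  have θ1' : 0 < 1 - θ := by linarith
  have hB0 : 0 ≤ B := by positivity
  refine ⟨max (α ^ 2 / (2 * α - 1) * B + M₂) (B / l), le_max_of_le_right (by positivity),
    fun u v R h hst hχR => ?_⟩
  have cu : Continuous u := h.contDiff_left.continuous
  have cv : Continuous v := h.contDiff_right.continuous
  set D : ℝ := ∫ x in K, v x ^ (2 * α) with hD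
  have D0 : 0 ≤ D := integral_nonneg fun x => Real.rpow_nonneg (h.pos x).le _
  have hc2 (g : En n → ℝ) : HasCompactSupport fun x => g x * η x ^ 2 := by
    simp only [sq]; exact (hc.mul_left).mul_left
  have hint {g : En n → ℝ} (hg : Continuous g) : Integrable fun x => g x * η x ^ 2 :=
    (hg.mul (hη.continuous.pow 2)).integrable_of_hasCompactSupport (hc2 g)
  have hexp (c : ℝ) : Continuous fun x => Real.exp (c * u x) :=
    Real.continuous_exp.comp (cu.const_mul c)
  have hχ1 (x : En n) : χ x * η x ^ 2 = η x ^ 2 := by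
    by_cases hx : x ∈ K
    · rw [hχη x hx, one_mul]
    · rw [image_eq_zero_of_notMem_tsupport fun h => hx (hηK h)]; ring
  have stab {f : En n → ℝ} (hf : ContDiff ℝ 2 f) :
      ∫ x, Real.exp (1 / 2 * u x) * f x ^ 2 * η x ^ 2 ≤
        (1 + ε) * (∫ x, gradSq (fun y => f y * η y) x) + Cs * ∫ x, f x ^ 2 * η x ^ 2 := by
    have := hS u R cu hst hχR (fun y => f y * η y) ((hf.of_le (by norm_num)).mul hη1) hc.mul_left
    simp only [mul_pow] at this
    convert this using 3 with x
    linear_combination (-(Real.exp (1 / 2 * u x) * f x ^ 2)) * hχ1 x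
  have ef (x : En n) : Real.exp (α / 2 * u x) ^ 2 = Real.exp (α * u x) := by
    rw [← Real.exp_nat_mul]; congr 1; push_cast; ring
  have ev (x : En n) : (v x ^ α) ^ 2 = v x ^ (2 * α) := by
    rw [← Real.rpow_mul_natCast (h.pos x).le]; congr 1; push_cast; ring
  have hf1 : ContDiff ℝ 2 fun x => Real.exp (α / 2 * u x) :=
    (contDiff_const.mul h.contDiff_left).exp
  have hD1 : ∫ x in K, Real.exp (α * u x) ≤ D :=
    integral_mono ((hexp α).continuousOn.integrableOn_compact hK)
      ((h.continuous_rpow _).continuousOn.integrableOn_compact hK)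
      fun x => h.exp_le_rpow (by linarith) x
  have hD2 : ∫ x, Real.exp (α * u x) * η x ^ 2 ≤ D :=
    (integral_mul_sq_le (hexp α) (fun x => (Real.exp_pos _).le) h01 hK hηK).trans hD1
  have hD3 : ∫ x, v x ^ (2 * α) * η x ^ 2 ≤ D :=
    integral_mul_sq_le (h.continuous_rpow _) (fun x => Real.rpow_nonneg (h.pos x).le _) h01 hK hηK
  set P : ℝ := ∫ x, v x * Real.exp (α * u x) * η x ^ 2 with hP
  set Q : ℝ := ∫ x, Real.exp (u x) * v x ^ (2 * α - 1) * η x ^ 2 with hQ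
  set X : ℝ := ∫ x, Real.exp (1 / 2 * u x) * Real.exp (α * u x) * η x ^ 2 with hX
  set Y : ℝ := ∫ x, Real.exp (1 / 2 * u x) * v x ^ (2 * α) * η x ^ 2 with hY
  have g1 : ∫ x, gradSq (fun y => Real.exp (α / 2 * u y) * η y) x ≤ α / 4 * P + M₁ * D := by
    have := integral_gradSq_mul_le hf1 hη2 hc (gradSq_exp h.contDiff_left α) hM₁ hK.measurableSet
      ((hf1.continuous.pow 2).continuousOn.integrableOn_compact hK) hηK
    simp only [ef, h.lap_left, neg_neg, mul_assoc, integral_const_mul] at this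
    simp only [hP, mul_assoc]
    linarith [mul_le_mul_of_nonneg_left hD1 hM₁0]
  have g2 : ∫ x, gradSq (fun y => v y ^ α * η y) x ≤ α ^ 2 / (2 * α - 1) * Q + M₂ * D := by
    have := integral_gradSq_mul_le (h.contDiff_rpow α) hη2 hc
      (gradSq_rpow h.contDiff_right h.pos hm.ne') hM₂ hK.measurableSet
      (((h.continuous_rpow α).pow 2).continuousOn.integrableOn_compact hK) hηK
    simp only [ev, h.lap_right, neg_neg, mul_assoc, integral_const_mul] at this
    simpa only [hQ, mul_assoc] using this
  have hX1 : X ≤ a * P + B₁ * D := by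
    have := stab hf1
    simp only [ef] at this
    have h1 := mul_le_mul_of_nonneg_left g1 (show 0 ≤ 1 + ε by linarith)
    have h2 := mul_le_mul_of_nonneg_left hD2 Cs0
    simp only [ha, hB₁, hX]
    linarith
  have hY1 : Y ≤ b * Q + B₂ * D := by
    have := stab (h.contDiff_rpow α)
    simp only [ev] at this
    have h1 := mul_le_mul_of_nonneg_left g2 (show 0 ≤ 1 + ε by linarith)
    have h2 := mul_le_mul_of_nonneg_left hD3 Cs0
    simp only [hb, hB₂, hY]
    linarith
  have eE (x : En n) : Real.exp (α * u x) = Real.exp (1 / 2 * u x) ^ (2 * α) := by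
    rw [← Real.exp_mul]; congr 1; ring
  have eE2 (x : En n) : Real.exp (u x) = Real.exp (1 / 2 * u x) ^ 2 := by
    rw [← Real.exp_nat_mul]; congr 1; push_cast; ring
  have iP : Integrable fun x => v x * Real.exp (α * u x) * η x ^ 2 := hint (cv.mul (hexp α))
  have iQ : Integrable fun x => Real.exp (u x) * v x ^ (2 * α - 1) * η x ^ 2 :=
    hint ((Real.continuous_exp.comp cu).mul (h.continuous_rpow (2 * α - 1)))
  have iX : Integrable fun x => Real.exp (1 / 2 * u x) * Real.exp (α * u x) * η x ^ 2 :=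
    hint ((hexp (1 / 2)).mul (hexp α))
  have iY : Integrable fun x => Real.exp (1 / 2 * u x) * v x ^ (2 * α) * η x ^ 2 :=
    hint ((hexp (1 / 2)).mul (h.continuous_rpow (2 * α)))
  have habs' : l * (a * P) + b * Q ≤ θ * (l * X + Y) := by
    have e1 : l * (a * P) + b * Q = ∫ x, (l * (a * (v x * Real.exp (α * u x) * η x ^ 2)) +
        b * (Real.exp (u x) * v x ^ (2 * α - 1) * η x ^ 2)) := by
      rw [integral_add ((iP.const_mul a).const_mul l) (iQ.const_mul b)]
      simp only [integral_const_mul]; rfl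
    have e2 : θ * (l * X + Y) =
        ∫ x, θ * (l * (Real.exp (1 / 2 * u x) * Real.exp (α * u x) * η x ^ 2) +
          Real.exp (1 / 2 * u x) * v x ^ (2 * α) * η x ^ 2) := by
      rw [integral_const_mul, integral_add (iX.const_mul l) iY, integral_const_mul]
    rw [e1, e2]
    refine integral_mono (((iP.const_mul a).const_mul l).add (iQ.const_mul b))
      (((iX.const_mul l).add iY).const_mul θ) fun x => ?_
    have := mul_le_mul_of_nonneg_right (habs (Real.exp (1 / 2 * u x)) (v x) (Real.exp_pos _)
      (h.pos x)) (sq_nonneg (η x))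
    simp only [eE, eE2]
    linarith
  have hQY : Q ≤ Y := by
    refine integral_mono iQ iY fun x => mul_le_mul_of_nonneg_right ?_ (sq_nonneg _)
    have e1 : v x ^ (2 * α) = v x ^ (2 * α - 1) * v x := by
      rw [Real.rpow_sub_one (h.pos x).ne', div_mul_cancel₀ _ (h.pos x).ne']
    simp only [e1, eE2]
    have : 0 ≤ Real.exp (1 / 2 * u x) * v x ^ (2 * α - 1) :=
      mul_nonneg (Real.exp_pos _).le (Real.rpow_nonneg (h.pos x).le _)
    nlinarith [mul_le_mul_of_nonneg_left (h.exp_half_le x) this]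
  have X0 : 0 ≤ X := integral_nonneg fun x => by positivity
  have Y0 : 0 ≤ Y := integral_nonneg fun x =>
    mul_nonneg (mul_nonneg (Real.exp_pos _).le (Real.rpow_nonneg (h.pos x).le _)) (sq_nonneg _)
  have hXY : l * X + Y ≤ B * D := by
    rw [hB, div_mul_eq_mul_div, le_div_iff₀ θ1']
    nlinarith [mul_le_mul_of_nonneg_left hX1 l0.le]
  constructor
  · refine le_trans ?_ (mul_le_mul_of_nonneg_right (le_max_left _ _) D0)
    have h1 : Q ≤ B * D := by nlinarith [mul_nonneg l0.le X0]
    have h2 : 0 ≤ α ^ 2 / (2 * α - 1) := by positivity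
    nlinarith [mul_le_mul_of_nonneg_left h1 h2]
  · refine le_trans ?_ (mul_le_mul_of_nonneg_right (le_max_right _ _) D0)
    have h1 : ∫ x, Real.exp ((α + 1 / 2) * u x) * η x ^ 2 = X := by
      simp only [hX]
      congr 1; ext x
      rw [← Real.exp_add]; congr 2; ring
    rw [h1, div_mul_eq_mul_div, le_div_iff₀ l0]
    linarith

/-- A locally uniform `L^q` bound, on annuli, for a one-parameter family. -/
def AnnulusBdd {n : ℕ} (V : ℝ → En n → ℝ) (q : ℝ) : Prop :=
  ∀ a b : ℝ, 0 < a → a ≤ b → ∃ C : ℝ, ∀ᶠ r in atTop, ∫ x in annulus n a b, V r x ^ q ≤ C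

lemma AnnulusBdd.mono {n : ℕ} {V : ℝ → En n → ℝ} {p q : ℝ} (h : AnnulusBdd V q)
    (hV : ∀ r, 0 < r → Continuous (V r)) (h0 : ∀ r, 0 < r → ∀ x, 0 < V r x) (hp : 0 ≤ p)
    (hpq : p ≤ q) : AnnulusBdd V p := by
  intro a b ha hab
  obtain ⟨C, hC⟩ := h a b ha hab
  refine ⟨(∫ _ in annulus n a b, (1 : ℝ)) + C, ?_⟩
  filter_upwards [hC, eventually_gt_atTop 0] with r hr hr0
  have hi (s : ℝ) : IntegrableOn (fun x => V r x ^ s) (annulus n a b) :=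
    ((hV r hr0).rpow_const fun x => Or.inl (h0 r hr0 x).ne').continuousOn.integrableOn_compact
      (isCompact_annulus n a b)
  have h1 : IntegrableOn (fun _ : En n => (1 : ℝ)) (annulus n a b) :=
    continuousOn_const.integrableOn_compact (isCompact_annulus n a b)
  refine le_trans ?_ (add_le_add le_rfl hr)
  rw [← integral_add h1 (hi q)]
  refine integral_mono (hi p) (h1.add (hi q)) fun x => ?_
  have hx := h0 r hr0 x
  have hq : 0 ≤ V r x ^ q := Real.rpow_nonneg hx.le _
  rcases le_total (V r x) 1 with h | h
  · simp only
    linarith [Real.rpow_le_one hx.le h hp]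
  · simp only
    linarith [Real.rpow_le_rpow_of_exponent_le h hpq]

/-- Passing from an energy bound to a higher integrability bound. -/
lemma AnnulusBdd.of_energy {n : ℕ} (hn : 2 < n) {V : ℝ → En n → ℝ} {β : ℝ}
    (hV : ∀ r, 0 < r → ContDiff ℝ 1 fun x => V r x ^ β) (h0 : ∀ r, 0 < r → ∀ x, 0 < V r x)
    (henergy : ∀ a b : ℝ, 0 < a → a ≤ b → ∃ (η : En n → ℝ) (C : ℝ), ContDiff ℝ 1 η ∧
      HasCompactSupport η ∧ (∀ x ∈ annulus n a b, η x = 1) ∧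
      ∀ᶠ r in atTop, ∫ x, gradSq (fun y => V r y ^ β * η y) x ≤ C) :
    AnnulusBdd V (β * (2 * n / (n - 2))) := by
  intro a b ha hab
  have hn' : (2 : ℝ) < n := by exact_mod_cast hn
  obtain ⟨S, hS0, hS⟩ := sobolev hn
  obtain ⟨η, C, hη, hc, hη1, hC⟩ := henergy a b ha hab
  refine ⟨S * C ^ (n / (n - 2) : ℝ), ?_⟩
  filter_upwards [hC, eventually_gt_atTop 0] with r hr hr0
  have hw : ContDiff ℝ 1 fun y => V r y ^ β * η y := (hV r hr0).mul hη
  have hwc : HasCompactSupport fun y => V r y ^ β * η y := hc.mul_left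
  have hq : (0 : ℝ) < 2 * n / (n - 2) := div_pos (by linarith) (by linarith)
  have h1 := hS _ hw hwc
  have hκ : (0 : ℝ) ≤ n / (n - 2) := div_nonneg (by linarith) (by linarith)
  have hG : 0 ≤ ∫ x, gradSq (fun y => V r y ^ β * η y) x :=
    integral_nonneg fun x => gradSq_nonneg _ x
  refine le_trans ?_ (h1.trans (mul_le_mul_of_nonneg_left (Real.rpow_le_rpow hG hr hκ) hS0))
  have hint : Integrable fun x => |V r x ^ β * η x| ^ (2 * n / (n - 2) : ℝ) := by
    refine (hw.continuous.abs.rpow_const fun x => Or.inr hq.le).integrable_of_hasCompactSupport ?_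
    exact hwc.comp_left (g := fun t => |t| ^ (2 * n / (n - 2) : ℝ))
      (by simp [Real.zero_rpow hq.ne'])
  have h2 : ∫ x in annulus n a b, V r x ^ (β * (2 * n / (n - 2))) =
      ∫ x in annulus n a b, |V r x ^ β * η x| ^ (2 * n / (n - 2) : ℝ) := by
    refine setIntegral_congr_fun (measurableSet_annulus n a b) fun x hx => ?_
    rw [hη1 x hx, mul_one, abs_of_pos (Real.rpow_pos_of_pos (h0 r hr0 x) _),
      ← Real.rpow_mul (h0 r hr0 x).le]
  rw [h2]
  exact setIntegral_le_integral hint (.of_forall fun x => by positivity)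

end

section

open scoped ContDiff

lemma IsSystemSol.rescale {n : ℕ} {u v : En n → ℝ} (h : IsSystemSol u v) {r : ℝ} (hr : 0 < r) :
    IsSystemSol (fun x => u (r • x) + 4 * Real.log r) fun x => r ^ 2 * v (r • x) := by
  have hs : ContDiff ℝ 2 fun x : En n => r • x := contDiff_const_smul r
  have cu : ContDiff ℝ 2 fun x => u (r • x) := h.contDiff_left.comp hs
  have cv : ContDiff ℝ 2 fun x => v (r • x) := h.contDiff_right.comp hs
  have hc (c : ℝ) (x : En n) : lap (fun _ : En n => c) x = 0 := by
    simp [lap]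
  refine ⟨cu.add contDiff_const, contDiff_const.mul cv, fun x => ?_, fun x => ?_, fun x => ?_⟩
  · rw [lap_add cu contDiff_const, lap_comp_smul h.contDiff_left, h.lap_left, hc]; ring
  · rw [lap_const_mul _ cv, lap_comp_smul h.contDiff_right, h.lap_right, Real.exp_add,
      mul_comm 4, ← Real.rpow_def_of_pos hr]
    norm_cast
    ring
  · have e : (1 / 2 : ℝ) * (u (r • x) + 4 * Real.log r) =
        1 / 2 * u (r • x) + Real.log r * (2 : ℕ) := by push_cast; ring
    rw [e, Real.exp_add, ← Real.rpow_def_of_pos hr, Real.rpow_natCast, mul_comm]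
    exact mul_le_mul_of_nonneg_left (h.exp_half_le _) (sq_nonneg r)

lemma Stable4OutsideBall.rescale {n : ℕ} {u : En n → ℝ} {R : ℝ} (h : Stable4OutsideBall n u R)
    {r : ℝ} (hr : 0 < r) :
    Stable4OutsideBall n (fun x => u (r • x) + 4 * Real.log r) (R / r) := by
  rintro φ ⟨hφ, hc, hs⟩
  have hr' : r⁻¹ ≠ 0 := inv_ne_zero hr.ne'
  have h1 := h (fun x => φ (r⁻¹ • x)) ⟨hφ.comp (contDiff_const_smul _), hc.comp_smul hr', ?_⟩
  · have e1 := Measure.integral_comp_smul volume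
      (fun x : En n => Real.exp (u x) * φ (r⁻¹ • x) ^ 2) r
    have e2 := Measure.integral_comp_smul volume
      (fun x : En n => lap (fun x => φ (r⁻¹ • x)) x ^ 2) r
    have hk (x : En n) : lap (fun x => φ (r⁻¹ • x)) (r • x) ^ 2 = (r⁻¹) ^ 4 * lap φ x ^ 2 := by
      rw [lap_comp_smul (contDiff_infty.1 hφ 2), inv_smul_smul₀ hr.ne']; ring
    simp only [hk, inv_smul_smul₀ hr.ne', integral_const_mul, smul_eq_mul] at e1 e2
    have h2 := mul_le_mul_of_nonneg_left h1 (abs_nonneg (r ^ Module.finrank ℝ (En n))⁻¹)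
    rw [← e1, ← e2] at h2
    have e3 (x : En n) : Real.exp (u (r • x) + 4 * Real.log r) * φ x ^ 2 =
        r ^ 4 * (Real.exp (u (r • x)) * φ x ^ 2) := by
      rw [Real.exp_add, mul_comm 4, ← Real.rpow_def_of_pos hr]
      norm_cast
      ring
    simp only [e3, integral_const_mul]
    refine (mul_le_mul_of_nonneg_left h2 (by positivity : 0 ≤ r ^ 4)).trans_eq ?_
    field_simp
  · refine (tsupport_comp_subset_preimage φ (continuous_const_smul r⁻¹)).trans fun x hx => ?_
    have h2 := hs hx
    simp only [mem_compl_iff, mem_closedBall_zero_iff, not_le, norm_smul, norm_inv,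
      Real.norm_of_nonneg hr.le, ← div_eq_inv_mul] at h2 ⊢
    exact (div_lt_div_iff_of_pos_right hr).1 h2

section Family

variable {n : ℕ} {U V : ℝ → En n → ℝ} {R : ℝ}

lemma AnnulusBdd.of_one (hn : 2 < n) (hsys : ∀ r, 0 < r → IsSystemSol (U r) (V r))
    (h : AnnulusBdd V 1) {q : ℝ} (hq : 0 ≤ q) (hqn : q < n / (n - 2)) : AnnulusBdd V q := by
  have hn' : (2 : ℝ) < n := by exact_mod_cast hn
  have hn2 : (0 : ℝ) < n - 2 := by linarith
  have hκ : (0 : ℝ) < n / (n - 2) := div_pos (by linarith) hn2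
  set β : ℝ := q / (n / (n - 2)) / 2 with hβ
  have hβ0 : 0 ≤ β := by positivity
  have hβ1 : β < 1 / 2 := by
    have := (div_lt_one hκ).2 hqn
    rw [hβ]; linarith
  have hV0 : ∀ r, 0 < r → ∀ x, 0 < V r x := fun r hr => (hsys r hr).pos
  have h2 : AnnulusBdd V (2 * β) :=
    h.mono (fun r hr => (hsys r hr).contDiff_right.continuous) hV0 (by linarith) (by linarith)
  have e : q = β * (2 * n / (n - 2)) := by rw [hβ]; field_simp
  rw [e]
  refine AnnulusBdd.of_energy hn
    (fun r hr => ((hsys r hr).contDiff_rpow β).of_le (by norm_num)) hV0 fun a b ha hab => ?_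
  obtain ⟨η, hη, hc, -, hη1, hηs⟩ := exists_annulus_cutoff n ha hab
  obtain ⟨C, hC0, hC⟩ := IsSystemSol.integral_gradSq_rpow_le_of_lt_half (contDiff_infty.1 hη 2) hc
    (isCompact_annulus n (a / 2) (2 * b)) hηs hβ1
  obtain ⟨D, hD⟩ := h2 (a / 2) (2 * b) (by linarith) (by linarith)
  refine ⟨η, C * D, contDiff_infty.1 hη 1, hc, hη1, ?_⟩
  filter_upwards [hD, eventually_gt_atTop 0] with r hr hr0
  exact (hC _ _ (hsys r hr0)).trans (mul_le_mul_of_nonneg_left hr hC0)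

lemma AnnulusBdd.of_stable (hsys : ∀ r, 0 < r → IsSystemSol (U r) (V r))
    (hst : ∀ r, 0 < r → Stable4OutsideBall n (U r) (R / r)) {α : ℝ} (hα : 1 / 2 < α)
    (hα3 : α ^ 3 - 8 * α + 4 < 0) (h : AnnulusBdd V (2 * α)) {a b : ℝ} (ha : 0 < a) (hab : a ≤ b) :
    ∃ (η : En n → ℝ) (C : ℝ), ContDiff ℝ 1 η ∧ HasCompactSupport η ∧
      (∀ x ∈ annulus n a b, η x = 1) ∧ ∀ᶠ r in atTop,
        ∫ x, gradSq (fun y => V r y ^ α * η y) x ≤ C ∧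
        ∫ x in annulus n a b, Real.exp ((α + 1 / 2) * U r x) ≤ C := by
  obtain ⟨η, hη, hc, hη01, hη1, hηs⟩ := exists_annulus_cutoff n ha hab
  obtain ⟨χ, hχ, hχc, hχ01, hχ1, hχs⟩ := exists_annulus_cutoff n (a := a / 2) (b := 2 * b)
    (by linarith) (by linarith)
  obtain ⟨C, hC0, hC⟩ := IsSystemSol.stable_energy_le hη hc hη01
    (isCompact_annulus n (a / 2) (2 * b)) hηs hχ hχc hχ01 hχ1 hα hα3
  obtain ⟨D, hD⟩ := h (a / 2) (2 * b) (by linarith) (by linarith)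
  refine ⟨η, C * D, contDiff_infty.1 hη 1, hc, hη1, ?_⟩
  filter_upwards [hD, eventually_gt_atTop 0, eventually_gt_atTop (4 * R / a)] with r hr hr0 hra
  have hsub : tsupport χ ⊆ (closedBall 0 (R / r))ᶜ := fun x hx => by
    have h1 := (mem_annulus.1 (hχs hx)).1
    rw [div_lt_iff₀ ha] at hra
    have h2 : R / r < a / 2 / 2 := by rw [div_lt_iff₀ hr0]; linarith
    simp only [mem_compl_iff, mem_closedBall_zero_iff, not_le]
    linarith
  obtain ⟨e1, e2⟩ := hC _ _ _ (hsys r hr0) (hst r hr0) hsub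
  have hCD := mul_le_mul_of_nonneg_left hr hC0
  refine ⟨e1.trans hCD, le_trans ?_ (e2.trans hCD)⟩
  have hcont : Continuous fun x => Real.exp ((α + 1 / 2) * U r x) * η x ^ 2 :=
    (Real.continuous_exp.comp ((hsys r hr0).contDiff_left.continuous.const_mul _)).mul
      (hη.continuous.pow 2)
  have hi : Integrable fun x => Real.exp ((α + 1 / 2) * U r x) * η x ^ 2 := by
    refine hcont.integrable_of_hasCompactSupport ?_
    simp only [sq]; exact hc.mul_left.mul_left
  refine le_trans (le_of_eq ?_) (setIntegral_le_integral (s := annulus n a b) hi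
    (.of_forall fun x => by positivity))
  refine setIntegral_congr_fun (measurableSet_annulus n a b) fun x hx => ?_
  simp [hη1 x hx]

/-- Moser iteration along the range of exponents allowed by stability. -/
lemma AnnulusBdd.of_one_of_stable (hn : 2 < n) (hsys : ∀ r, 0 < r → IsSystemSol (U r) (V r))
    (hst : ∀ r, 0 < r → Stable4OutsideBall n (U r) (R / r)) {αs αst : ℝ} (hαs : 1 / 2 < αs)
    (hcubic : ∀ α, αs < α → α < αst → α ^ 3 - 8 * α + 4 < 0)
    (hdim : 2 * αs < n / ((n : ℝ) - 2)) (h : AnnulusBdd V 1) {α : ℝ} (h1 : αs < α) (h2 : α < αst) :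
    AnnulusBdd V (2 * α) := by
  have hn' : (2 : ℝ) < n := by exact_mod_cast hn
  have hn2 : (0 : ℝ) < n - 2 := by linarith
  set κ : ℝ := n / (n - 2) with hκ
  have hκ1 : 1 < κ := by rw [hκ, lt_div_iff₀ hn2]; linarith
  have hV : ∀ r, 0 < r → Continuous (V r) := fun r hr => (hsys r hr).contDiff_right.continuous
  have hV0 : ∀ r, 0 < r → ∀ x, 0 < V r x := fun r hr => (hsys r hr).pos
  obtain ⟨α₁, h3, h4⟩ := exists_between (lt_min h1 (show αs < κ / 2 by linarith))
  obtain ⟨h5, h6⟩ := lt_min_iff.1 h4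
  have key (k : ℕ) : AnnulusBdd V (2 * min α (κ ^ k * α₁)) := by
    induction k with
    | zero =>
      rw [pow_zero, one_mul, min_eq_right h5.le]
      exact h.of_one hn hsys (by linarith) (by linarith)
    | succ k ih =>
      set γ := min α (κ ^ k * α₁) with hγ
      have hγ1 : αs < γ := lt_min h1 (by nlinarith [one_le_pow₀ (n := k) hκ1.le])
      have hγ2 : γ < αst := (min_le_left _ _).trans_lt h2
      have h7 : AnnulusBdd V (γ * (2 * n / (n - 2))) :=
        AnnulusBdd.of_energy hn (fun r hr => ((hsys r hr).contDiff_rpow γ).of_le (by norm_num)) hV0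
          fun a b ha hab => by
            obtain ⟨η, C, e1, e2, e3, e4⟩ := AnnulusBdd.of_stable hsys hst (by linarith)
              (hcubic γ hγ1 hγ2) ih ha hab
            exact ⟨η, C, e1, e2, e3, e4.mono fun r hr => hr.1⟩
      have e : γ * (2 * n / (n - 2)) = 2 * (γ * κ) := by rw [hκ]; ring
      rw [e] at h7
      have hα₁ : 0 < α₁ := by linarith
      refine h7.mono hV hV0 ?_ ?_
      · have : 0 < κ ^ (k + 1) * α₁ := by positivity
        have := lt_min (show 0 < α by linarith) this
        linarith
      · refine mul_le_mul_of_nonneg_left ?_ zero_le_two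
        rw [hγ, min_mul_of_nonneg _ _ (by linarith)]
        refine min_le_min ?_ (le_of_eq (by ring))
        nlinarith
  obtain ⟨k, hk⟩ := pow_unbounded_of_one_lt (α / α₁) hκ1
  have := key k
  rwa [min_eq_left ((div_le_iff₀ (by linarith)).1 hk.le)] at this

/-- Uniform bounds for exponential integrals over annuli. -/
lemma exists_integral_exp_annulus_le (hn : 2 < n) (hsys : ∀ r, 0 < r → IsSystemSol (U r) (V r))
    (hst : ∀ r, 0 < r → Stable4OutsideBall n (U r) (R / r)) {αs αst : ℝ} (hαs : 1 / 2 < αs)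
    (hlt : αs < αst) (hcubic : ∀ α, αs < α → α < αst → α ^ 3 - 8 * α + 4 < 0)
    (hdim : 2 * αs < n / ((n : ℝ) - 2)) (h : AnnulusBdd V 1) {p : ℝ} (hp : 0 ≤ p)
    (hpα : p < n / ((n : ℝ) - 2) * αst ∨ p < αst + 1 / 2) {a b : ℝ} (ha : 0 < a) (hab : a ≤ b) :
    ∃ C, ∀ᶠ r in atTop, ∫ x in annulus n a b, Real.exp (p * U r x) ≤ C := by
  have hn' : (2 : ℝ) < n := by exact_mod_cast hn
  have hn2 : (0 : ℝ) < n - 2 := by linarith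
  have hκ : (0 : ℝ) < n / (n - 2) := div_pos (by linarith) hn2
  have hi (r : ℝ) (hr : 0 < r) (q : ℝ) :
      IntegrableOn (fun x => Real.exp (q * U r x)) (annulus n a b) :=
    (Real.continuous_exp.comp
      ((hsys r hr).contDiff_left.continuous.const_mul q)).continuousOn.integrableOn_compact
      (isCompact_annulus n a b)
  rcases hpα with hpα | hpα
  · obtain ⟨α, h1, h2⟩ := exists_between (max_lt hlt ((div_lt_iff₀' hκ).2 hpα))
    obtain ⟨h3, h4⟩ := max_lt_iff.1 h1
    have h5 := AnnulusBdd.of_one_of_stable hn hsys hst hαs hcubic hdim h h3 h2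
    have h7 : AnnulusBdd V (α * (2 * n / (n - 2))) :=
      AnnulusBdd.of_energy hn (fun r hr => ((hsys r hr).contDiff_rpow α).of_le (by norm_num))
        (fun r hr => (hsys r hr).pos) fun a b ha hab => by
          obtain ⟨η, C, e1, e2, e3, e4⟩ := AnnulusBdd.of_stable hsys hst (by linarith)
            (hcubic α h3 h2) h5 ha hab
          exact ⟨η, C, e1, e2, e3, e4.mono fun r hr => hr.1⟩
    have h8 : AnnulusBdd V (2 * p) := by
      refine h7.mono (fun r hr => (hsys r hr).contDiff_right.continuous)
        (fun r hr => (hsys r hr).pos) (by linarith) ?_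
      have := (div_lt_iff₀' hκ).1 h4
      have e : α * (2 * n / (n - 2)) = 2 * (n / (n - 2) * α) := by ring
      rw [e]; linarith
    obtain ⟨C, hC⟩ := h8 a b ha hab
    refine ⟨C, ?_⟩
    filter_upwards [hC, eventually_gt_atTop 0] with r hr hr0
    exact (integral_mono (hi r hr0 p) (((hsys r hr0).continuous_rpow _).continuousOn
      |>.integrableOn_compact (isCompact_annulus n a b))
      fun x => (hsys r hr0).exp_le_rpow hp x).trans hr
  · obtain ⟨α, h1, h2⟩ := exists_between (max_lt hlt (show p - 1 / 2 < αst by linarith))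
    obtain ⟨h3, h4⟩ := max_lt_iff.1 h1
    have h5 := AnnulusBdd.of_one_of_stable hn hsys hst hαs hcubic hdim h h3 h2
    obtain ⟨η, C, -, -, -, hC⟩ := AnnulusBdd.of_stable hsys hst (by linarith)
      (hcubic α h3 h2) h5 ha hab
    refine ⟨(∫ _ in annulus n a b, (1 : ℝ)) + C, ?_⟩
    filter_upwards [hC, eventually_gt_atTop 0] with r hr hr0
    have hone : IntegrableOn (fun _ : En n => (1 : ℝ)) (annulus n a b) :=
      continuousOn_const.integrableOn_compact (isCompact_annulus n a b)
    refine le_trans ?_ (add_le_add le_rfl hr.2)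
    rw [← integral_add hone (hi r hr0 _)]
    refine integral_mono (hi r hr0 p) (hone.add (hi r hr0 _)) fun x => ?_
    simp only
    rcases le_total (U r x) 0 with hx | hx
    · have : Real.exp (p * U r x) ≤ 1 := Real.exp_le_one_iff.2 (mul_nonpos_of_nonneg_of_nonpos hp hx)
      linarith [Real.exp_pos ((α + 1 / 2) * U r x)]
    · have : Real.exp (p * U r x) ≤ Real.exp ((α + 1 / 2) * U r x) :=
        Real.exp_le_exp.2 (mul_le_mul_of_nonneg_right (by linarith) hx)
      linarith

end Family

end

section

open scoped Pointwise

/-- Location of the two largest roots of `X ^ 3 - 8 X + 4`, and sign between them. -/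
lemma cubic_roots {αs αst : ℝ} (hr1 : αst ^ 3 - 8 * αst + 4 = 0) (hr2 : αs ^ 3 - 8 * αs + 4 = 0)
    (hmax : ∀ x : ℝ, x ^ 3 - 8 * x + 4 = 0 → x ≤ αst)
    (hsecond : ∀ x : ℝ, x ^ 3 - 8 * x + 4 = 0 → x ≠ αst → x ≤ αs) :
    1 / 2 < αs ∧ ∀ α, αs < α → α < αst → α ^ 3 - 8 * α + 4 < 0 := by
  have hc : Continuous fun x : ℝ => x ^ 3 - 8 * x + 4 := by fun_prop
  obtain ⟨x, ⟨hx1, hx2⟩, hx⟩ := intermediate_value_Icc' (a := (1 / 2 : ℝ)) (b := 1) (by norm_num)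
    hc.continuousOn (show (0 : ℝ) ∈ _ by constructor <;> norm_num)
  obtain ⟨y, ⟨hy1, hy2⟩, hy⟩ := intermediate_value_Icc (a := (2 : ℝ)) (b := 3) (by norm_num)
    hc.continuousOn (show (0 : ℝ) ∈ _ by constructor <;> norm_num)
  have hyst := hmax y hy
  have hxs := hsecond x hx (by linarith)
  have hx3 : x ≠ 1 / 2 := by
    rintro rfl
    norm_num at hx
  have hs : 1 / 2 < αs := (lt_of_le_of_ne hx1 hx3.symm).trans_le hxs
  refine ⟨hs, fun α h1 h2 => ?_⟩
  have hfac : αst ^ 2 + αst * αs + αs ^ 2 = 8 := by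
    have h3 : (αst - αs) * (αst ^ 2 + αst * αs + αs ^ 2 - 8) = 0 := by linear_combination hr1 - hr2
    rcases mul_eq_zero.1 h3 with h3 | h3 <;> linarith
  have e : α ^ 3 - 8 * α + 4 = (α - αst) * (α - αs) * (α + αst + αs) := by
    linear_combination hr1 + (α - αst) * hfac
  rw [e]
  exact mul_neg_of_neg_of_pos (mul_neg_of_neg_of_pos (by linarith) (by linarith)) (by linarith)

/-- A function whose increments over dyadic intervals are `O(r ^ s)`, `s > 0`, is `O(r ^ s)`. -/
lemma exists_le_rpow_of_dyadic {I : ℝ → ℝ} {C s r₀ : ℝ} (hs : 0 < s) (hr₀ : 1 ≤ r₀)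
    (hI : ∀ r, r₀ ≤ r → ∀ r', r ≤ r' → I r ≤ I r')
    (hd : ∀ r, r₀ ≤ r → I (2 * r) ≤ I r + C * r ^ s) :
    ∃ C' > 0, ∀ r, r₀ ≤ r → I r ≤ C' * r ^ s := by
  have h2s : (1 : ℝ) < 2 ^ s := Real.one_lt_rpow one_lt_two hs
  have hs1 : (0 : ℝ) < 2 ^ s - 1 := by linarith
  refine ⟨max 1 (max (I (2 * r₀)) (C / (2 ^ s - 1))), by positivity, ?_⟩
  set C' : ℝ := max 1 (max (I (2 * r₀)) (C / (2 ^ s - 1))) with hC'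
  have h1 : 1 ≤ C' := le_max_left _ _
  have h2 : I (2 * r₀) ≤ C' := (le_max_left _ _).trans (le_max_right _ _)
  have h3 : C / (2 ^ s - 1) ≤ C' := (le_max_right _ _).trans (le_max_right _ _)
  rw [div_le_iff₀ hs1] at h3
  have key (k : ℕ) : ∀ r, r₀ ≤ r → r ≤ 2 ^ (k + 1) * r₀ → I r ≤ C' * r ^ s := by
    induction k with
    | zero =>
      intro r hr hr2
      have : 1 ≤ r ^ s := Real.one_le_rpow (hr₀.trans hr) hs.le
      have h4 := hI r hr (2 * r₀) (by simpa using hr2)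
      nlinarith
    | succ k ih =>
      intro r hr hr2
      rcases le_total r (2 * r₀) with h | h
      · exact ih r hr (h.trans (by
          rw [pow_succ]
          nlinarith [one_le_pow₀ (n := k) (one_le_two (α := ℝ))]))
      · have h5 := ih (r / 2) (by linarith) (by rw [pow_succ] at hr2; linarith)
        have h6 := hd (r / 2) (by linarith)
        have e1 : 2 * (r / 2) = r := by ring
        have e2 : r ^ s = 2 ^ s * (r / 2) ^ s := by
          rw [← Real.mul_rpow zero_le_two (by linarith), e1]
        have h7 : 0 ≤ (r / 2) ^ s := Real.rpow_nonneg (by linarith) _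
        rw [e1] at h6
        rw [e2]
        nlinarith [mul_le_mul_of_nonneg_right h3 h7]
  intro r hr
  obtain ⟨k, hk⟩ := pow_unbounded_of_one_lt r (one_lt_two (α := ℝ))
  refine key k r hr ?_
  rw [pow_succ]
  have : (0 : ℝ) < 2 ^ k := by positivity
  nlinarith

lemma integrableOn_exp_diff_ball {n : ℕ} {u : En n → ℝ} (hu : Continuous u) (p a b : ℝ) :
    IntegrableOn (fun x => Real.exp (p * u x)) (ball (0 : En n) a \ ball 0 b) :=
  ((Real.continuous_exp.comp (hu.const_mul p)).continuousOn.integrableOn_compact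
    (isCompact_closedBall (0 : En n) a)).mono_set
    (sdiff_subset.trans ball_subset_closedBall)

/-- Scaling back a uniform bound on a fixed annulus. -/
lemma integral_exp_diff_ball_le_of_rescale {n : ℕ} {u : En n → ℝ} (hu : Continuous u) {p C r : ℝ}
    (hr : 0 < r)
    (h : ∫ x in annulus n 1 2, Real.exp (p * (u (r • x) + 4 * Real.log r)) ≤ C) :
    ∫ x in ball (0 : En n) (2 * r) \ ball (0 : En n) r, Real.exp (p * u x) ≤
      C * r ^ ((n : ℝ) - 4 * p) := by
  have e1 : ball (0 : En n) (2 * r) \ ball (0 : En n) r = r • (ball (0 : En n) 2 \ ball 0 1) := by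
    rw [smul_set_sdiff₀ hr.ne', _root_.smul_ball hr.ne', _root_.smul_ball hr.ne', smul_zero,
      Real.norm_of_nonneg hr.le, mul_one, mul_comm]
  have e2 := Measure.setIntegral_comp_smul_of_pos volume (fun x : En n => Real.exp (p * u x))
    (ball (0 : En n) 2 \ ball 0 1) hr
  rw [finrank_euclideanSpace_fin, ← e1, smul_eq_mul] at e2
  have e3 (x : En n) : Real.exp (p * (u (r • x) + 4 * Real.log r)) =
      r ^ (4 * p) * Real.exp (p * u (r • x)) := by
    rw [Real.rpow_def_of_pos hr, ← Real.exp_add]; congr 1; ring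
  have hcont : Continuous fun x : En n => Real.exp (p * u (r • x)) :=
    Real.continuous_exp.comp ((hu.comp (continuous_const_smul r)).const_mul p)
  have h1 : ∫ x in ball (0 : En n) 2 \ ball 0 1, Real.exp (p * u (r • x)) ≤
      ∫ x in annulus n 1 2, Real.exp (p * u (r • x)) := by
    refine setIntegral_mono_set
      (hcont.continuousOn.integrableOn_compact (isCompact_annulus n 1 2))
      (.of_forall fun x => (Real.exp_pos _).le) (LE.le.eventuallyLE ?_)
    exact sdiff_subset_sdiff_left ball_subset_closedBall
  simp only [e3, integral_const_mul] at h
  have hn0 : (0 : ℝ) < r ^ n := pow_pos hr n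
  have h4 : (0 : ℝ) < r ^ (4 * p) := Real.rpow_pos_of_pos hr _
  rw [Real.rpow_sub hr, Real.rpow_natCast]
  rw [inv_mul_eq_div, eq_div_iff hn0.ne'] at e2
  rw [← e2, ← mul_div_assoc, le_div_iff₀ h4]
  have := (mul_le_mul_of_nonneg_left h1 h4.le).trans h
  nlinarith

end

/-- (Lemma 6.7 of the paper; `L^p` estimates for `e^u`.) Let `n > 4` with
`n/(n-2) > 2α♯`, where `α♯ < α*` are the two largest real roots of `X³ - 8X + 4`.  Let
`u ∈ C⁴(ℝ^n)` solve `Δ²u = e^u`, be stable outside `B_R` in the fourth-order sense, with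
`Δu → 0` at infinity, and set `ᾱ = max{ (n/(n-2)) min{n/4, α*}, min{n/4, α*} + 1/2 }`.
Then for every `p ∈ [1, ᾱ)`: `∫_{B_{2r}\B_r} e^{pu} ≤ C(p) r^{n-4p}` for all large `r`;
and for every `p ∈ [1, min{n/4, α*})`: `∫_{B_r \ B_{2R}} e^{pu} ≤ C(p) r^{n-4p}` for all
large `r`. -/
theorem Lp_estimates_fourth_order
    (n : ℕ) (hn : 4 < n)
    (αs αst : ℝ)
    (hr1 : αst ^ 3 - 8 * αst + 4 = 0) (hr2 : αs ^ 3 - 8 * αs + 4 = 0)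
    (hlt : αs < αst)
    (hmax : ∀ x : ℝ, x ^ 3 - 8 * x + 4 = 0 → x ≤ αst)
    (hsecond : ∀ x : ℝ, x ^ 3 - 8 * x + 4 = 0 → x ≠ αst → x ≤ αs)
    (hdim : (n : ℝ) / ((n : ℝ) - 2) > 2 * αs)
    (u : En n → ℝ) (hu : ContDiff ℝ (4 : ℕ) u)
    (heq : ∀ x, lap (fun y => lap u y) x = Real.exp (u x))
    (R : ℝ) (hR : 0 < R) (hstable : Stable4OutsideBall n u R)
    (hvanish : Filter.Tendsto (fun x => lap u x) (Filter.cocompact (En n)) (nhds 0)) :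
    (∀ p : ℝ, 1 ≤ p →
        p < max ((n / ((n : ℝ) - 2)) * min ((n : ℝ) / 4) αst) (min ((n : ℝ) / 4) αst + 1/2) →
        ∃ C > (0:ℝ), ∃ r₀ : ℝ, ∀ r : ℝ, r₀ ≤ r →
          ∫ x in Metric.ball (0 : En n) (2 * r) \ Metric.ball (0 : En n) r,
              Real.exp (p * u x) ≤ C * r ^ ((n : ℝ) - 4 * p)) ∧
      (∀ p : ℝ, 1 ≤ p → p < min ((n : ℝ) / 4) αst →
        ∃ C > (0:ℝ), ∃ r₀ : ℝ, ∀ r : ℝ, r₀ ≤ r →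
          ∫ x in Metric.ball (0 : En n) r \ Metric.ball (0 : En n) (2 * R),
              Real.exp (p * u x) ≤ C * r ^ ((n : ℝ) - 4 * p)) := by
  obtain ⟨hαs, hcubic⟩ := cubic_roots hr1 hr2 hmax hsecond
  have hn2 : 2 < n := by omega
  have hn' : (4 : ℝ) < n := by exact_mod_cast hn
  have hneg := lap_nonpos_of_tendsto hu heq hvanish
  have hu2 : ContDiff ℝ 2 u := hu.of_le (by norm_num)
  have hl : ContDiff ℝ 2 (lap u) := ContDiff.lap hu (by norm_num)
  have hsol : IsSystemSol u fun x => -lap u x :=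
    ⟨hu2, hl.neg, fun x => (neg_neg _).symm, fun x => by rw [lap_neg]; exact congrArg _ (heq x),
      exp_half_le_neg_lap hu heq hneg⟩
  set U : ℝ → En n → ℝ := fun r x => u (r • x) + 4 * Real.log r with hU
  set V : ℝ → En n → ℝ := fun r x => r ^ 2 * -lap u (r • x) with hV
  have hsys : ∀ r, 0 < r → IsSystemSol (U r) (V r) := fun r hr => hsol.rescale hr
  have hst : ∀ r, 0 < r → Stable4OutsideBall n (U r) (R / r) := fun r hr => hstable.rescale hr
  have hone : AnnulusBdd V 1 := by
    intro a b ha hab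
    obtain ⟨C, r₀, hr₀, hC⟩ := integral_comp_smul_le_of_lap_eq_neg hn hsol.contDiff_right
      (Real.continuous_exp.comp hu.continuous) (fun x => (hsol.pos x).le)
      (fun x => (Real.exp_pos _).le) hsol.lap_right (by simpa using hvanish.neg)
      (hstable.integral_exp_ball_le hn hu.continuous hR) (b := 2 * b) (by linarith)
    refine ⟨C, ?_⟩
    filter_upwards [eventually_ge_atTop r₀] with r hr
    have hr0 : 0 < r := hr₀.trans_le hr
    simp only [Real.rpow_one]
    refine le_trans (setIntegral_mono_set ?_ (.of_forall fun x => ((hsys r hr0).pos x).le)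
      (LE.le.eventuallyLE fun x hx => ?_)) (hC r hr)
    · exact ((hsys r hr0).contDiff_right.continuous.continuousOn.integrableOn_compact
        (isCompact_closedBall (0 : En n) (2 * b))).mono_set ball_subset_closedBall
    · rw [mem_ball_zero_iff]
      linarith [(mem_annulus.1 hx).2]
  have main (p : ℝ) (hp : 1 ≤ p)
      (hpα : p < n / ((n : ℝ) - 2) * αst ∨ p < αst + 1 / 2) :
      ∃ C > (0 : ℝ), ∃ r₀ : ℝ, 0 < r₀ ∧ ∀ r : ℝ, r₀ ≤ r →
        ∫ x in ball (0 : En n) (2 * r) \ ball (0 : En n) r, Real.exp (p * u x) ≤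
          C * r ^ ((n : ℝ) - 4 * p) := by
    obtain ⟨C, hC⟩ := exists_integral_exp_annulus_le hn2 hsys hst hαs hlt hcubic hdim hone
      (by linarith) hpα one_pos one_le_two
    obtain ⟨r₀, hr₀⟩ := eventually_atTop.1 hC
    refine ⟨max C 1, by positivity, max r₀ 1, by positivity, fun r hr => ?_⟩
    have hr0 : 0 < r := one_pos.trans_le ((le_max_right _ _).trans hr)
    refine (integral_exp_diff_ball_le_of_rescale hu.continuous hr0
      (hr₀ r ((le_max_left _ _).trans hr))).trans ?_
    exact mul_le_mul_of_nonneg_right (le_max_left _ _) (Real.rpow_nonneg hr0.le _)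
  have hκ : (0 : ℝ) ≤ n / ((n : ℝ) - 2) := div_nonneg (by linarith) (by linarith)
  refine ⟨fun p hp hpα => ?_, fun p hp hpα => ?_⟩
  · obtain ⟨C, hC, r₀, -, h⟩ := main p hp ((lt_max_iff.1 hpα).imp
      (fun h => h.trans_le (mul_le_mul_of_nonneg_left (min_le_right _ _) hκ))
      fun h => h.trans_le (by linarith [min_le_right ((n : ℝ) / 4) αst]))
    exact ⟨C, hC, r₀, h⟩
  · obtain ⟨h1, h2⟩ := lt_min_iff.1 hpα
    obtain ⟨C, hC, r₀, hr₀, h⟩ := main p hp (Or.inr (by linarith))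
    set r₁ : ℝ := max r₀ (max 1 (2 * R)) with hr₁
    have hr₁0 : r₀ ≤ r₁ := le_max_left _ _
    have hr₁1 : 1 ≤ r₁ := (le_max_left _ _).trans (le_max_right _ _)
    have hi := integrableOn_exp_diff_ball hu.continuous p
    obtain ⟨C', hC', h'⟩ := exists_le_rpow_of_dyadic
      (I := fun r => ∫ x in ball (0 : En n) r \ ball (0 : En n) (2 * R), Real.exp (p * u x))
      (s := n - 4 * p) (by linarith) hr₁1
      (fun r _ r' hrr' => setIntegral_mono_set (hi r' _) (.of_forall fun x => (Real.exp_pos _).le)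
        (LE.le.eventuallyLE (sdiff_subset_sdiff_left (ball_subset_ball hrr'))))
      fun r hr => by
        refine le_trans ?_ (add_le_add le_rfl (h r (hr₁0.trans hr)))
        have hdisj : Disjoint (ball (0 : En n) r \ ball (0 : En n) (2 * R))
            (ball (0 : En n) (2 * r) \ ball (0 : En n) r) :=
          disjoint_sdiff_right.mono_left sdiff_subset
        rw [← setIntegral_union hdisj (measurableSet_ball.diff measurableSet_ball) (hi _ _)
          (hi _ _)]
        refine setIntegral_mono_set ((hi _ _).union (hi _ _))
          (.of_forall fun x => (Real.exp_pos _).le) (LE.le.eventuallyLE ?_)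
        rintro x ⟨hx1, hx2⟩
        by_cases hx : x ∈ ball (0 : En n) r
        · exact Or.inl ⟨hx, hx2⟩
        · exact Or.inr ⟨hx1, hx⟩
    exact ⟨C', hC', r₁, h'⟩
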